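/- arXiv:1506.05517 — 4 statements merged into one kernel-verified Lean document; each statement's English description precedes it below -/
import Mathlib

section
/- For every n ≥ 4, the centralizer of σ_1²σ_3^{−2} in J_n (that is, the group of all elements of J_n commuting with σ_1²σ_3^{−2} in B_n) is isomorphic to the direct product P_{n−2} × ℤ, where P_{n−2} is the pure braid group on n−2 strings. -/
/-- Relators of the Artin presentation of the braid group on `n` strings:
generators `σ_0, …, σ_{n-2}` (0-based), with `σ_i σ_j = σ_j σ_i` for `|i-j| > 1`
and `σ_i σ_j σ_i = σ_j σ_i σ_j` for `|i-j| = 1`. -/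
def braidRels (n : ℕ) : Set (FreeGroup (Fin (n - 1))) :=
  {r | (∃ i j : Fin (n - 1), (i : ℕ) + 2 ≤ (j : ℕ) ∧
          r = FreeGroup.of i * FreeGroup.of j * (FreeGroup.of i)⁻¹ * (FreeGroup.of j)⁻¹) ∨
       (∃ i j : Fin (n - 1), (j : ℕ) = (i : ℕ) + 1 ∧
          r = FreeGroup.of i * FreeGroup.of j * FreeGroup.of i *
              (FreeGroup.of j * FreeGroup.of i * FreeGroup.of j)⁻¹)}

/-- The braid group `B_n`, presented by Artin generators and relations. -/
abbrev BraidGroup (n : ℕ) := PresentedGroup (braidRels n)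

/-- The Artin generator `σ_{i+1}` (1-based), i.e. `σ i` for `i : Fin (n-1)` (0-based). -/
def σ {n : ℕ} (i : Fin (n - 1)) : BraidGroup n := PresentedGroup.of i

section FreeProduct

open Monoid

namespace Monoid.CoprodI

variable {ι : Type*} {M : ι → Type*} [∀ i, Group (M i)]

/-- The index of the first syllable of the normal form of `w`, if `w ≠ 1`. -/
noncomputable def firstIdx (w : CoprodI M) : Option ι := by
  classical exact (Word.equiv w).fstIdx

theorem firstIdx_prod (w : Word M) : firstIdx w.prod = w.fstIdx := by
  classical
  unfold firstIdx
  congr 1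
  exact Word.equiv.apply_symm_apply w

@[simp]
theorem firstIdx_one : firstIdx (1 : CoprodI M) = none :=
  firstIdx_prod Word.empty

theorem exists_word_prod_eq (w : CoprodI M) : ∃ v : Word M, v.prod = w := by
  classical
  exact ⟨Word.equiv w, Word.equiv.symm_apply_apply w⟩

theorem firstIdx_of_mul {i : ι} {m : M i} {w : CoprodI M} (hm : m ≠ 1)
    (hw : firstIdx w ≠ some i) : firstIdx (of m * w) = some i := by
  obtain ⟨v, rfl⟩ := exists_word_prod_eq w
  rw [firstIdx_prod] at hw
  rw [← Word.prod_cons i m v hm hw, firstIdx_prod, Word.fstIdx_cons]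

theorem firstIdx_of {i : ι} {m : M i} (hm : m ≠ 1) : firstIdx (of m : CoprodI M) = some i := by
  simpa using firstIdx_of_mul (w := 1) hm (by simp)

theorem firstIdx_induction {C : CoprodI M → Prop} (one : C 1)
    (of_mul : ∀ (i : ι) (m : M i) (w : CoprodI M), m ≠ 1 → firstIdx w ≠ some i → C w →
      C (of m * w)) (w : CoprodI M) : C w := by
  obtain ⟨v, rfl⟩ := exists_word_prod_eq w
  induction v using Word.consRecOn with
  | empty => exact one
  | cons i m w h₁ h₂ ih =>
    rw [Word.prod_cons]
    exact of_mul i m _ h₂ (by rwa [firstIdx_prod]) ih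

theorem exists_eq_of_mul (i : ι) (w : CoprodI M) :
    ∃ (h : M i) (t : CoprodI M), w = of h * t ∧ firstIdx t ≠ some i := by
  induction w using firstIdx_induction with
  | one => exact ⟨1, 1, by simp, by simp⟩
  | of_mul j m w hm hw _ =>
    by_cases hij : j = i
    · subst hij
      exact ⟨m, w, rfl, hw⟩
    · exact ⟨1, of m * w, by simp, by rw [firstIdx_of_mul hm hw]; simpa using hij⟩

theorem firstIdx_map {Ψ : CoprodI M →* CoprodI M} {ψ : ∀ i, M i →* M i}
    (hψ : ∀ i, Function.Injective (ψ i)) (hΨ : ∀ i (m : M i), Ψ (of m) = of (ψ i m))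
    (w : CoprodI M) : firstIdx (Ψ w) = firstIdx w := by
  induction w using firstIdx_induction with
  | one => simp
  | of_mul i m w hm hw ih =>
    rw [map_mul, hΨ, firstIdx_of_mul hm hw, firstIdx_of_mul _ (by rwa [ih])]
    exact (map_ne_one_iff _ (hψ i)).2 hm

theorem firstIdx_mul_of {i : ι} (g : M i) (w : CoprodI M) :
    firstIdx (w * of g) = firstIdx w ∨ ∃ h : M i, w = of h := by
  classical
  induction w using firstIdx_induction with
  | one => exact Or.inr ⟨1, by simp⟩
  | of_mul j m w hm hw ih =>
    rw [firstIdx_of_mul hm hw, mul_assoc]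
    rcases ih with ih | ⟨h, rfl⟩
    · exact Or.inl (firstIdx_of_mul hm (by rwa [ih]))
    · by_cases hij : j = i
      · subst hij
        exact Or.inr ⟨m * h, by simp⟩
      · refine Or.inl (firstIdx_of_mul hm ?_)
        rw [← map_mul]
        by_cases h1 : h * g = 1
        · simp [h1]
        · rw [firstIdx_of h1]
          simpa using Ne.symm hij

/-- If `Ψ` preserves the factors of a free product and is the identity on the factor `M i`, then
`w * x = x * Ψ w` with `1 ≠ x ∈ M i` forces `w ∈ M i`. -/
theorem mem_factor_of_mul_eq {Ψ : CoprodI M →* CoprodI M} {ψ : ∀ i, M i →* M i}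
    (hψ : ∀ i, Function.Injective (ψ i)) (hΨ : ∀ i (m : M i), Ψ (of m) = of (ψ i m))
    {i : ι} (hi : ∀ m, ψ i m = m) {x : M i} (hx : x ≠ 1) {w : CoprodI M}
    (hw : w * of x = of x * Ψ w) : ∃ h : M i, w = of h := by
  obtain ⟨h, t, ht, hti⟩ := exists_eq_of_mul i w⁻¹
  have key : of (h⁻¹ * x⁻¹ * h) * t = Ψ t * of x⁻¹ := by
    have h₁ := congrArg (·⁻¹) hw
    simp only [mul_inv_rev, ← map_inv Ψ, ht, map_mul, hΨ, hi] at h₁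
    rw [map_mul, map_mul, mul_assoc, mul_assoc, map_inv of h, map_inv of x, inv_mul_eq_iff_eq_mul]
    simpa [mul_assoc] using h₁
  have hne : h⁻¹ * x⁻¹ * h ≠ 1 := by
    intro h₁
    apply hx
    have h₂ : x⁻¹ = h * (h⁻¹ * x⁻¹ * h) * h⁻¹ := by group
    simpa [h₁] using h₂
  have hfst := firstIdx_of_mul hne hti
  rw [key] at hfst
  rcases firstIdx_mul_of x⁻¹ (Ψ t) with h₁ | ⟨k, hk⟩
  · rw [h₁, firstIdx_map hψ hΨ] at hfst
    exact absurd hfst hti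
  · have ht1 : t = of ((h⁻¹ * x⁻¹ * h)⁻¹ * (k * x⁻¹)) := by
      rw [map_mul, map_mul, ← hk, ← key, map_inv, inv_mul_cancel_left]
    refine ⟨(h * ((h⁻¹ * x⁻¹ * h)⁻¹ * (k * x⁻¹)))⁻¹, ?_⟩
    rw [map_inv, map_mul, ← ht1, ← ht, inv_inv]

end Monoid.CoprodI

namespace FreeGroup

variable {α : Type*}

/-- The inclusion of a colour class into the free product of the colour classes. -/
def colorIncl (p : α → Bool) (b : Bool) : FreeGroup {a // p a = b} →*
    CoprodI fun b : Bool => FreeGroup {a // p a = b} :=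
  CoprodI.of (M := fun b : Bool => FreeGroup {a // p a = b}) (i := b)

/-- The splitting of a free group as a free product along a two-valued colouring of its basis. -/
noncomputable def toCoprodI (p : α → Bool) :
    FreeGroup α →* CoprodI fun b : Bool => FreeGroup {a // p a = b} :=
  FreeGroup.lift fun a => colorIncl p (p a) (FreeGroup.of ⟨a, rfl⟩)

theorem toCoprodI_of (p : α → Bool) {b : Bool} (a : {a // p a = b}) :
    toCoprodI p (FreeGroup.of (a : α)) = colorIncl p b (FreeGroup.of a) := by
  obtain ⟨a, rfl⟩ := a
  simp [toCoprodI]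

theorem toCoprodI_map (p : α → Bool) {b : Bool} (w : FreeGroup {a // p a = b}) :
    toCoprodI p (FreeGroup.map Subtype.val w) = colorIncl p b w := by
  have : (toCoprodI p).comp (FreeGroup.map Subtype.val) = colorIncl p b := by
    ext a
    simp [toCoprodI_of]
  exact DFunLike.congr_fun this w

theorem toCoprodI_injective (p : α → Bool) : Function.Injective (toCoprodI p) := by
  let r : (CoprodI fun b : Bool => FreeGroup {a // p a = b}) →* FreeGroup α :=
    CoprodI.lift fun b => FreeGroup.map Subtype.val
  have h : r.comp (toCoprodI p) = MonoidHom.id _ := by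
    ext a
    simp [r, toCoprodI, colorIncl]
  exact Function.LeftInverse.injective (g := r) (DFunLike.congr_fun h)

/-- Let `ψ` fix the basis elements of colour `true`, and conjugate those of colour `false` by a
word `c` in basis elements of colour `false`. If `w * x = x * ψ w`, where `x ≠ 1` is a word in
basis elements of colour `true`, then so is `w`. -/
theorem mem_range_map_of_mul_eq (p : α → Bool) {ψ : FreeGroup α →* FreeGroup α}
    (c : FreeGroup {a // p a = false}) (h_true : ∀ a, p a = true → ψ (of a) = of a)
    (h_false : ∀ a, p a = false → ψ (of a) = (map Subtype.val c)⁻¹ * of a * map Subtype.val c)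
    {x : FreeGroup {a // p a = true}} (hx : x ≠ 1) {w : FreeGroup α}
    (hw : w * map Subtype.val x = map Subtype.val x * ψ w) :
    ∃ v : FreeGroup {a // p a = true}, w = map Subtype.val v := by
  let φ : ∀ b : Bool, FreeGroup {a // p a = b} →* FreeGroup {a // p a = b}
    | true => MonoidHom.id _
    | false => (MulAut.conj c⁻¹).toMonoidHom
  have hφ : ∀ b, Function.Injective (φ b)
    | true => Function.injective_id
    | false => (MulAut.conj c⁻¹).injective
  let Φ : (CoprodI fun b : Bool => FreeGroup {a // p a = b}) →*
      CoprodI fun b : Bool => FreeGroup {a // p a = b} :=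
    CoprodI.lift fun b => (colorIncl p b).comp (φ b)
  have hΦ : ∀ b (m : FreeGroup {a // p a = b}), Φ (colorIncl p b m) = colorIncl p b (φ b m) :=
    fun b m => by simp [Φ, colorIncl]
  have hcomp : (toCoprodI p).comp ψ = Φ.comp (toCoprodI p) := by
    ext a
    cases hp : p a with
    | true =>
      have := toCoprodI_of p ⟨a, hp⟩
      simp only [MonoidHom.comp_apply, h_true a hp, this, hΦ]
      rfl
    | false =>
      have := toCoprodI_of p ⟨a, hp⟩
      simp only [MonoidHom.comp_apply, h_false a hp, _root_.map_mul, _root_.map_inv,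
        toCoprodI_map, this, hΦ]
      simp [φ]
  obtain ⟨v, hv⟩ := CoprodI.mem_factor_of_mul_eq (Ψ := Φ) hφ hΦ (i := true) (fun _ => rfl) hx
    (w := toCoprodI p w) (by
      have h := congrArg (toCoprodI p) hw
      rw [_root_.map_mul, _root_.map_mul, toCoprodI_map] at h
      exact h.trans (congrArg (colorIncl p true x * ·) (DFunLike.congr_fun hcomp w)))
  exact ⟨v, toCoprodI_injective p (by rw [toCoprodI_map]; exact hv)⟩

theorem mem_zpowers_of_commute_of {a : α} {w : FreeGroup α} (hw : Commute w (of a)) :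
    w ∈ Subgroup.zpowers (of a) := by
  classical
  obtain ⟨v, rfl⟩ := mem_range_map_of_mul_eq (fun b => decide (b = a))
    (ψ := MonoidHom.id _) 1 (fun _ _ => rfl) (fun _ _ => by simp)
    (x := of ⟨a, by simp⟩) (of_ne_one _) (w := w) (by simpa using hw.eq)
  have hle : (map Subtype.val : FreeGroup {b // decide (b = a) = true} →* _).range ≤
      Subgroup.zpowers (of a) := by
    rw [MonoidHom.range_eq_map, ← FreeGroup.closure_range_of, MonoidHom.map_closure,
      Subgroup.closure_le]
    rintro _ ⟨_, ⟨⟨b, hb⟩, rfl⟩, rfl⟩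
    obtain rfl : b = a := by simpa using hb
    simp
  exact hle ⟨v, rfl⟩

end FreeGroup

end FreeProduct

section BraidGroup

namespace BraidGroup

/-- The Artin generator with 0-based index `i : ℕ`, or `1` if there is no such generator. -/
def gen (n i : ℕ) : BraidGroup n := if h : i + 1 < n then σ ⟨i, by omega⟩ else 1

theorem gen_eq_σ {n i : ℕ} (h : i + 1 < n) : gen n i = σ ⟨i, by omega⟩ := dif_pos h

section lift

variable {G : Type*} [Group G] {n : ℕ} (s : ∀ i, i + 1 < n → G)
  (hcomm : ∀ i j (hi : i + 1 < n) (hj : j + 1 < n), i + 2 ≤ j → s i hi * s j hj = s j hj * s i hi)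
  (hbraid : ∀ i (hi : i + 1 < n) (hj : i + 1 + 1 < n),
    s i hi * s (i + 1) hj * s i hi = s (i + 1) hj * s i hi * s (i + 1) hj)

/-- The homomorphism from the braid group given by elements satisfying the braid relations. -/
def lift : BraidGroup n →* G :=
  PresentedGroup.toGroup (f := fun i : Fin (n - 1) => s i (by omega)) <| by
    rintro r (⟨i, j, hij, rfl⟩ | ⟨i, j, hij, rfl⟩)
    · simp only [map_mul, FreeGroup.lift_apply_of, map_inv]
      rw [hcomm i j _ _ hij]
      group
    · obtain ⟨j, hj⟩ := j
      obtain rfl : j = i + 1 := hij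
      simp only [map_mul, FreeGroup.lift_apply_of, map_inv]
      rw [mul_inv_eq_one]
      exact hbraid i _ _

theorem lift_gen {i : ℕ} (h : i + 1 < n) : lift s hcomm hbraid (gen n i) = s i h := by
  rw [gen_eq_σ h]
  exact PresentedGroup.toGroup.of _

end lift

variable {n : ℕ}

theorem gen_mul_comm {i j : ℕ} (h : i + 2 ≤ j) : gen n i * gen n j = gen n j * gen n i := by
  by_cases hj : j + 1 < n
  · rw [gen_eq_σ hj, gen_eq_σ (show i + 1 < n by omega)]
    have := PresentedGroup.one_of_mem (rels := braidRels n)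
      (Or.inl ⟨⟨i, by omega⟩, ⟨j, by omega⟩, h, rfl⟩)
    simp only [map_mul, map_inv] at this
    rwa [mul_inv_eq_one, mul_inv_eq_iff_eq_mul] at this
  · simp [gen, hj]

theorem gen_braid {i : ℕ} (h : i + 2 < n) :
    gen n i * gen n (i + 1) * gen n i = gen n (i + 1) * gen n i * gen n (i + 1) := by
  rw [gen_eq_σ (show i + 1 + 1 < n by omega), gen_eq_σ (show i + 1 < n by omega)]
  have := PresentedGroup.one_of_mem (rels := braidRels n)
    (Or.inr ⟨⟨i, by omega⟩, ⟨i + 1, by omega⟩, rfl, rfl⟩)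
  simp only [map_mul, map_inv] at this
  rwa [mul_inv_eq_one] at this

@[elab_as_elim]
theorem induction {p : BraidGroup n → Prop} (gen : ∀ i, i + 1 < n → p (gen n i)) (one : p 1)
    (mul : ∀ a b, p a → p b → p (a * b)) (inv : ∀ a, p a → p a⁻¹) (b : BraidGroup n) : p b := by
  have hb : b ∈ Subgroup.closure (Set.range PresentedGroup.of) := by
    rw [PresentedGroup.closure_range_of]
    trivial
  induction hb using Subgroup.closure_induction with
  | mem x hx =>
    obtain ⟨i, rfl⟩ := hx
    rw [show PresentedGroup.of i = BraidGroup.gen n i from (gen_eq_σ (by omega)).symm]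
    exact gen i (by omega)
  | one => exact one
  | mul x y _ _ hx hy => exact mul x y hx hy
  | inv x _ hx => exact inv x hx

theorem hom_ext {G : Type*} [Group G] {f g : BraidGroup n →* G}
    (h : ∀ i, i + 1 < n → f (gen n i) = g (gen n i)) : f = g :=
  PresentedGroup.ext fun i => by
    have := h i (by omega)
    rwa [gen_eq_σ (by omega)] at this

/-- The permutation of the strings induced by a braid. -/
def perm (n : ℕ) : BraidGroup n →* Equiv.Perm (Fin n) :=
  lift (fun i h => Equiv.swap ⟨i, by omega⟩ ⟨i + 1, h⟩)
    (by
      intro i j hi hj hij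
      rw [Equiv.mul_swap_eq_swap_mul, Equiv.swap_apply_of_ne_of_ne,
        Equiv.swap_apply_of_ne_of_ne] <;> simp <;> omega)
    (by
      intro i hi hj
      rw [Equiv.swap_comm (⟨i, _⟩ : Fin n), Equiv.swap_comm (⟨i + 1, _⟩ : Fin n) ⟨i + 1 + 1, _⟩,
        Equiv.swap_mul_swap_mul_swap (by simp) (by simp; omega),
        Equiv.swap_comm _ (⟨i + 1, _⟩ : Fin n), Equiv.swap_comm (⟨i + 1, _⟩ : Fin n) ⟨i, _⟩,
        Equiv.swap_mul_swap_mul_swap (by simp) (by simp; omega), Equiv.swap_comm])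

theorem perm_gen {i : ℕ} (h : i + 1 < n) :
    perm n (gen n i) = Equiv.swap ⟨i, by omega⟩ ⟨i + 1, h⟩ :=
  lift_gen _ _ _ h

/-- The exponent sum of a braid. -/
def expSum (n : ℕ) : BraidGroup n →* Multiplicative ℤ :=
  lift (fun _ _ => Multiplicative.ofAdd 1) (fun _ _ _ _ _ => rfl) fun _ _ _ => rfl

theorem expSum_gen {i : ℕ} (h : i + 1 < n) : expSum n (gen n i) = Multiplicative.ofAdd 1 :=
  lift_gen _ _ _ h

theorem ker_expSum : (expSum n).ker = commutator (BraidGroup n) := by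
  apply le_antisymm
  · intro b hb
    rw [← Abelianization.ker_of, MonoidHom.mem_ker]
    have hgen : ∀ i, i + 1 < n → Abelianization.of (gen n i) = Abelianization.of (gen n 0) := by
      intro i
      induction i with
      | zero => exact fun _ => rfl
      | succ i ih =>
        intro hi
        have h := congrArg Abelianization.of (gen_braid (n := n) (i := i) (by omega))
        simp only [map_mul] at h
        rw [← ih (by omega), mul_comm (Abelianization.of (gen n (i + 1)))] at *
        exact (mul_left_cancel h).symm
    have hfac : Abelianization.of = (zpowersHom _ (Abelianization.of (gen n 0))).comp (expSum n) :=
      hom_ext fun i hi => by simp [expSum_gen hi, hgen i hi]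
    rw [hfac, MonoidHom.comp_apply, hb, map_one]
  · exact Abelianization.commutator_subset_ker _

theorem even_expSum {b : BraidGroup n} (hb : perm n b = 1) :
    Even (Multiplicative.toAdd (expSum n b)) := by
  have h : Equiv.Perm.sign.comp (perm n) = (zpowersHom ℤˣ (-1)).comp (expSum n) :=
    hom_ext fun i hi => by
      rw [MonoidHom.comp_apply, MonoidHom.comp_apply, perm_gen hi, expSum_gen hi,
        Equiv.Perm.sign_swap (by simp)]
      simp
  have h' := DFunLike.congr_fun h b
  simp only [MonoidHom.comp_apply, hb, map_one, zpowersHom_apply] at h'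
  by_contra hodd
  rw [Int.not_even_iff_odd] at hodd
  rw [hodd.neg_one_zpow] at h'
  exact absurd h' (by decide)

end BraidGroup

end BraidGroup

section ArtinAction

namespace BraidGroup

/-- The `j`-th basis element of the free group of rank `m`, or `1` if `m ≤ j`. -/
def fgen (m j : ℕ) : FreeGroup (Fin m) := if h : j < m then FreeGroup.of ⟨j, h⟩ else 1

variable {m : ℕ}

theorem fgen_eq_of {j : ℕ} (h : j < m) : fgen m j = FreeGroup.of ⟨j, h⟩ := dif_pos h

theorem of_eq_fgen (j : Fin m) : FreeGroup.of j = fgen m j := (fgen_eq_of j.2).symm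

theorem lift_fgen {G : Type*} [Group G] {f : ℕ → G} {j : ℕ} (h : j < m) :
    FreeGroup.lift (fun j : Fin m => f j) (fgen m j) = f j := by
  rw [fgen_eq_of h, FreeGroup.lift_apply_of]

theorem freeHom_ext {G : Type*} [Group G] {f g : FreeGroup (Fin m) →* G}
    (h : ∀ j, j < m → f (fgen m j) = g (fgen m j)) : f = g :=
  FreeGroup.ext_hom _ _ fun j => by rw [of_eq_fgen]; exact h j j.2

/-- The images of the basis elements under the `i`-th Artin automorphism. -/
def artinFun (m i j : ℕ) : FreeGroup (Fin m) :=
  if j = i then fgen m (i + 1)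
  else if j = i + 1 then (fgen m (i + 1))⁻¹ * fgen m i * fgen m (i + 1)
  else fgen m j

/-- The images of the basis elements under the inverse of the `i`-th Artin automorphism. -/
def artinInvFun (m i j : ℕ) : FreeGroup (Fin m) :=
  if j = i then fgen m i * fgen m (i + 1) * (fgen m i)⁻¹
  else if j = i + 1 then fgen m i
  else fgen m j

/-- The endomorphism of the free group given by `artinFun`. -/
def artinHom (m i : ℕ) : FreeGroup (Fin m) →* FreeGroup (Fin m) :=
  FreeGroup.lift fun j : Fin m => artinFun m i j

/-- The endomorphism of the free group given by `artinInvFun`. -/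
def artinInvHom (m i : ℕ) : FreeGroup (Fin m) →* FreeGroup (Fin m) :=
  FreeGroup.lift fun j : Fin m => artinInvFun m i j

theorem artinHom_fgen {i j : ℕ} (h : j < m) : artinHom m i (fgen m j) = artinFun m i j :=
  lift_fgen h

theorem artinInvHom_fgen {i j : ℕ} (h : j < m) : artinInvHom m i (fgen m j) = artinInvFun m i j :=
  lift_fgen h

/-- The `i`-th Artin automorphism of the free group: `x_i ↦ x_{i+1}`,
`x_{i+1} ↦ x_{i+1}⁻¹ x_i x_{i+1}`. -/
def artinAut (i : ℕ) (h : i + 1 < m) : MulAut (FreeGroup (Fin m)) :=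
  MonoidHom.toMulEquiv (artinHom m i) (artinInvHom m i)
    (by
      have hi : i < m := by omega
      refine freeHom_ext fun j hj => ?_
      rw [MonoidHom.comp_apply, artinHom_fgen hj, artinFun]
      split_ifs <;>
        simp [*, artinInvHom_fgen, artinInvFun, mul_assoc])
    (by
      have hi : i < m := by omega
      refine freeHom_ext fun j hj => ?_
      rw [MonoidHom.comp_apply, artinInvHom_fgen hj, artinInvFun]
      split_ifs <;>
        simp [*, artinHom_fgen, artinFun, mul_assoc])

theorem artinAut_fgen {i j : ℕ} (h : i + 1 < m) : artinAut i h (fgen m j) = artinFun m i j := by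
  by_cases hj : j < m
  · exact artinHom_fgen hj
  · rw [artinFun, if_neg (by omega), if_neg (by omega), fgen, dif_neg hj, map_one]

/-- Artin's action of the braid group on the free group. -/
def artin (m : ℕ) : BraidGroup m →* MulAut (FreeGroup (Fin m)) :=
  lift artinAut
    (by
      intro i j hi hj hij
      refine MulEquiv.toMonoidHom_injective (freeHom_ext fun k _ => ?_)
      simp only [MulEquiv.coe_toMonoidHom, MulAut.mul_apply, artinAut_fgen, artinFun]
      split_ifs <;> simp only [map_mul, map_inv, artinAut_fgen, artinFun] <;>
        split_ifs <;> first | omega | rfl)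
    (by
      intro i hi hj
      refine MulEquiv.toMonoidHom_injective (freeHom_ext fun k _ => ?_)
      have h₁ : i ≠ i + 1 + 1 := by omega
      simp only [MulEquiv.coe_toMonoidHom, MulAut.mul_apply, artinAut_fgen]
      by_cases hk₁ : k = i
      · subst hk₁; simp [artinFun, artinAut_fgen, h₁, h₁.symm]
      by_cases hk₂ : k = i + 1
      · subst hk₂; simp [artinFun, artinAut_fgen, h₁, h₁.symm, mul_assoc]
      by_cases hk₃ : k = i + 1 + 1
      · subst hk₃; simp [artinFun, artinAut_fgen, h₁, h₁.symm, mul_assoc]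
      simp [artinFun, artinAut_fgen, *])

theorem artin_gen_fgen {i j : ℕ} (h : i + 1 < m) :
    artin m (gen m i) (fgen m j) = artinFun m i j := by
  rw [artin, lift_gen _ _ _ h, artinAut_fgen]

theorem isConj_artin_of (b : BraidGroup m) (j : Fin m) :
    IsConj (artin m b (FreeGroup.of j)) (FreeGroup.of (perm m b j)) := by
  induction b using induction generalizing j with
  | gen i h =>
    obtain ⟨j, hj⟩ := j
    rw [of_eq_fgen, artin_gen_fgen h, perm_gen h, artinFun, Equiv.swap_apply_def]
    simp only [Fin.mk.injEq]
    split_ifs with h₁ h₂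
    · rw [fgen_eq_of h]
    · rw [← fgen_eq_of, isConj_comm, isConj_iff]
      exact ⟨(fgen m (i + 1))⁻¹, by simp⟩
    · rw [fgen_eq_of hj]
  | one => rw [map_one, map_one]; exact IsConj.refl _
  | mul a b ha hb =>
    rw [map_mul, map_mul]
    exact ((artin m a).toMonoidHom.map_isConj (hb j)).trans (ha _)
  | inv a ha =>
    have h := ((artin m a⁻¹).toMonoidHom.map_isConj (ha ((perm m a)⁻¹ j))).symm
    simpa using h

theorem exists_artin_of_eq {b : BraidGroup m} (hb : perm m b = 1) (j : Fin m) :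
    ∃ u, artin m b (FreeGroup.of j) = u * FreeGroup.of j * u⁻¹ := by
  have h := (isConj_artin_of b j).symm
  rw [hb, isConj_iff] at h
  obtain ⟨u, hu⟩ := h
  exact ⟨u, hu.symm⟩

/-- The exponent sum of the basis element `x_j` in a word. -/
def fexp (j : Fin m) : FreeGroup (Fin m) →* Multiplicative ℤ :=
  FreeGroup.lift fun k => if k = j then Multiplicative.ofAdd 1 else 1

@[simp]
theorem fexp_of_self (j : Fin m) : fexp j (FreeGroup.of j) = Multiplicative.ofAdd 1 := by
  simp [fexp]

theorem fexp_artin {b : BraidGroup m} (hb : perm m b = 1) (j : Fin m) (w : FreeGroup (Fin m)) :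
    fexp j (artin m b w) = fexp j w := by
  have h : (fexp j).comp (artin m b).toMonoidHom = fexp j := by
    ext k
    obtain ⟨u, hu⟩ := exists_artin_of_eq hb k
    simp [hu]
  exact DFunLike.congr_fun h w

end BraidGroup

end ArtinAction

section Stabilizer

namespace BraidGroup

open SemidirectProduct

/-- The braid `σ_{j-1} ⋯ σ_1 σ_0`, moving the string in position `0` to position `j`. -/
def sweep (n : ℕ) : ℕ → BraidGroup n
  | 0 => 1
  | j + 1 => gen n j * sweep n j

/-- The pure braid in which the string in position `0` links once with that in position `j + 1`. -/
def loop (n j : ℕ) : BraidGroup n := (sweep n j)⁻¹ * gen n j ^ 2 * sweep n j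

section sweep

variable {n : ℕ}

theorem gen_commute_sweep {i j : ℕ} (h : j < i) : Commute (gen n i) (sweep n j) := by
  induction j with
  | zero => exact Commute.one_right _
  | succ j ih =>
    exact Commute.mul_right (show Commute (gen n i) (gen n j) from (gen_mul_comm (by omega)).symm)
      (ih (by omega))

theorem gen_mul_sweep {i j : ℕ} (h : i + 2 ≤ j) (hj : j < n) :
    gen n i * sweep n j = sweep n j * gen n (i + 1) := by
  induction j, h using Nat.le_induction with
  | base =>
    have h : gen n (i + 1) * sweep n i = sweep n i * gen n (i + 1) :=
      (gen_commute_sweep (Nat.lt_succ_self i)).eq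
    simp only [sweep, mul_assoc, ← h]
    simp only [← mul_assoc, gen_braid hj]
  | succ j hij ih =>
    rw [sweep, ← mul_assoc, gen_mul_comm hij, mul_assoc, ih (by omega), mul_assoc]

theorem gen_succ_mul_loop {i : ℕ} (h : i + 2 < n) :
    gen n (i + 1) * loop n i = loop n (i + 1) * gen n (i + 1) := by
  have hc := gen_commute_sweep (n := n) (Nat.lt_succ_self i)
  have hb := gen_braid h
  simp only [loop, sweep]
  generalize gen n i = a at *
  generalize gen n (i + 1) = b at *
  generalize sweep n i = t at *
  have key : b * a ^ 2 = a⁻¹ * b ^ 2 * a * b := by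
    rw [mul_assoc, mul_assoc, eq_inv_mul_iff_mul_eq]
    calc a * (b * a ^ 2) = a * b * a * a := by simp only [pow_two, mul_assoc]
      _ = b * a * b * a := by rw [hb]
      _ = b * (a * b * a) := by simp only [mul_assoc]
      _ = b ^ 2 * (a * b) := by rw [hb]; simp only [pow_two, mul_assoc]
  calc b * (t⁻¹ * a ^ 2 * t) = b * t⁻¹ * a ^ 2 * t := by simp only [mul_assoc]
    _ = t⁻¹ * (b * a ^ 2) * t := by rw [hc.inv_right.eq]; simp only [mul_assoc]
    _ = t⁻¹ * (a⁻¹ * b ^ 2 * a) * (b * t) := by rw [key]; simp only [mul_assoc]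
    _ = _ := by rw [hc.eq]; simp only [mul_inv_rev, mul_assoc]

theorem gen_succ_mul_loop_mul_loop {i : ℕ} (h : i + 2 < n) :
    gen n (i + 1) * (loop n i * loop n (i + 1)) = loop n i * loop n (i + 1) * gen n (i + 1) := by
  have hc := gen_commute_sweep (n := n) (Nat.lt_succ_self i)
  have hb := gen_braid h
  have hl : loop n i * loop n (i + 1) = (sweep n i)⁻¹ *
      (gen n i * gen n (i + 1) * (gen n (i + 1) * gen n i)) * sweep n i := by
    simp only [loop, sweep, pow_two]
    group
  rw [hl]
  generalize gen n i = a at *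
  generalize gen n (i + 1) = b at *
  generalize sweep n i = t at *
  have key : Commute b (a * b * (b * a)) := by
    calc b * (a * b * (b * a)) = b * a * b * (b * a) := by simp only [mul_assoc]
      _ = a * b * (a * b * a) := by rw [← hb]; simp only [mul_assoc]
      _ = a * b * (b * a) * b := by rw [hb]; simp only [mul_assoc]
  exact (hc.inv_right.mul_right key).mul_right hc

theorem gen_succ_mul_loop_succ {i : ℕ} (h : i + 2 < n) :
    gen n (i + 1) * loop n (i + 1) =
      (loop n (i + 1))⁻¹ * loop n i * loop n (i + 1) * gen n (i + 1) := by
  have h₁ := gen_succ_mul_loop_mul_loop h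
  rw [← mul_assoc, gen_succ_mul_loop h] at h₁
  rw [mul_assoc _ (loop n i), mul_assoc, eq_inv_mul_iff_mul_eq, ← h₁, mul_assoc]

theorem gen_succ_commute_loop {i j : ℕ} (h₁ : j ≠ i) (h₂ : j ≠ i + 1) (hj : j < n) :
    Commute (gen n (i + 1)) (loop n j) := by
  rcases Nat.lt_or_gt_of_ne h₁ with h | h
  · have hs : Commute (gen n (i + 1)) (sweep n j) := gen_commute_sweep (by omega)
    have hg : Commute (gen n (i + 1)) (gen n j) := (gen_mul_comm (by omega)).symm
    exact (hs.inv_right.mul_right (hg.pow_right 2)).mul_right hs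
  · have hs : gen n (i + 1) = (sweep n j)⁻¹ * gen n i * sweep n j := by
      rw [mul_assoc, gen_mul_sweep (by omega) hj, inv_mul_cancel_left]
    have hg : gen n i * gen n j ^ 2 = gen n j ^ 2 * gen n i :=
      (show Commute (gen n i) (gen n j) from gen_mul_comm (by omega)).pow_right 2
    rw [hs, loop]
    calc _ = (sweep n j)⁻¹ * (gen n i * gen n j ^ 2) * sweep n j := by group
      _ = _ := by rw [hg]; group

theorem perm_loop {j : ℕ} (h : j + 1 < n) : perm n (loop n j) = 1 := by
  simp only [loop, map_mul, map_inv, perm_gen h, pow_two, Equiv.swap_mul_self]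
  simp

end sweep

variable {m : ℕ}

/-- The inclusion of braid groups adding a trivial string in position `0`. -/
def shift (m : ℕ) : BraidGroup m →* BraidGroup (m + 1) :=
  lift (fun i _ => gen (m + 1) (i + 1)) (fun _ _ _ _ h => gen_mul_comm (by omega))
    fun _ _ _ => gen_braid (by omega)

theorem shift_gen {i : ℕ} (h : i + 1 < m) : shift m (gen m i) = gen (m + 1) (i + 1) :=
  lift_gen _ _ _ h

/-- The homomorphism from the free group to the braid group given by the braids `loop`. -/
def loopHom (m : ℕ) : FreeGroup (Fin m) →* BraidGroup (m + 1) :=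
  FreeGroup.lift fun j : Fin m => loop (m + 1) j

theorem loopHom_fgen {j : ℕ} (h : j < m) : loopHom m (fgen m j) = loop (m + 1) j := lift_fgen h

theorem loopHom_artin (b : BraidGroup m) (w : FreeGroup (Fin m)) :
    loopHom m (artin m b w) = shift m b * loopHom m w * (shift m b)⁻¹ := by
  induction b using induction generalizing w with
  | gen i h =>
    have hom : (loopHom m).comp (artin m (gen m i)).toMonoidHom =
        (MulAut.conj (shift m (gen m i))).toMonoidHom.comp (loopHom m) := by
      refine freeHom_ext fun j hj => ?_
      simp only [MonoidHom.comp_apply, MulEquiv.coe_toMonoidHom, artin_gen_fgen h,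
        MulAut.conj_apply, shift_gen h, loopHom_fgen hj, eq_mul_inv_iff_mul_eq, artinFun]
      split_ifs with h₁ h₂
      · subst h₁
        rw [loopHom_fgen h, gen_succ_mul_loop (by omega)]
      · subst h₂
        simp only [map_mul, map_inv, loopHom_fgen h, loopHom_fgen (show i < m by omega)]
        rw [gen_succ_mul_loop_succ (by omega)]
      · rw [loopHom_fgen hj, (gen_succ_commute_loop h₁ h₂ (by omega)).eq]
    exact DFunLike.congr_fun hom w
  | one => simp
  | mul a b ha hb =>
    rw [map_mul, MulAut.mul_apply, ha, hb, map_mul]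
    group
  | inv a ha =>
    have h := ha ((artin m a)⁻¹ w)
    rw [MulAut.apply_inv_self] at h
    rw [map_inv, h, map_inv]
    group

/-- The semidirect product of the free group and the braid group for Artin's action. It is
isomorphic to the stabilizer of position `0` in the braid group on one more string. -/
abbrev Stab (m : ℕ) := FreeGroup (Fin m) ⋊[artin m] BraidGroup m

/-- The embedding of `Stab m` as the stabilizer of position `0`. -/
def stabHom (m : ℕ) : Stab m →* BraidGroup (m + 1) :=
  SemidirectProduct.lift (loopHom m) (shift m) fun b => by
    ext1 w
    exact loopHom_artin b _

theorem stabHom_inl_fgen {j : ℕ} (h : j < m) :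
    stabHom m (inl (fgen m j)) = loop (m + 1) j := by
  rw [stabHom, lift_inl, loopHom_fgen h]

theorem stabHom_inr_gen {i : ℕ} (h : i + 1 < m) :
    stabHom m (inr (gen m i)) = gen (m + 1) (i + 1) := by
  rw [stabHom, lift_inr, shift_gen h]

theorem perm_stabHom_inl (w : FreeGroup (Fin m)) : perm (m + 1) (stabHom m (inl w)) = 1 := by
  have h : ((perm (m + 1)).comp (stabHom m)).comp inl = 1 := freeHom_ext fun j hj => by
    simp [stabHom_inl_fgen hj, perm_loop (n := m + 1) (j := j) (by omega)]
  exact DFunLike.congr_fun h w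

theorem perm_shift (b : BraidGroup m) :
    perm (m + 1) (shift m b) 0 = 0 ∧ ∀ j, perm (m + 1) (shift m b) j.succ = (perm m b j).succ := by
  induction b using induction with
  | gen i h =>
    rw [shift_gen h, perm_gen (by omega), perm_gen h]
    refine ⟨Equiv.swap_apply_of_ne_of_ne ?_ ?_, fun j => ?_⟩
    · simp [Fin.ext_iff]
    · simp [Fin.ext_iff]
    · have := (Fin.succ_injective m).swap_apply ⟨i, by omega⟩ ⟨i + 1, h⟩ j
      simpa using this
  | one => simp
  | mul a b ha hb => simp [ha, hb]
  | inv a ha =>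
    simp only [map_inv, Equiv.Perm.inv_eq_iff_eq, ha]
    simp

theorem perm_stabHom_eq_one_iff (g : Stab m) :
    perm (m + 1) (stabHom m g) = 1 ↔ perm m g.right = 1 := by
  have hg : perm (m + 1) (stabHom m g) = perm (m + 1) (shift m g.right) := by
    conv_lhs => rw [← inl_left_mul_inr_right g, map_mul, map_mul, perm_stabHom_inl, one_mul,
      stabHom, lift_inr]
  rw [hg]
  obtain ⟨h₀, h₁⟩ := perm_shift g.right
  constructor
  · intro h
    ext1 j
    have h₂ := h₁ j
    rw [h] at h₂
    exact (Fin.succ_injective m h₂).symm.trans (by simp)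
  · intro h
    ext1 j
    cases j using Fin.cases with
    | zero => simpa using h₀
    | succ j => rw [h₁, h]; simp

end BraidGroup

end Stabilizer

section Monodromy

namespace BraidGroup

open SemidirectProduct

variable {m : ℕ}

theorem inr_gen_mul_inl_fgen {i : ℕ} (h : i + 1 < m) (j : ℕ) :
    (inr (gen m i) * inl (fgen m j) : Stab m) = inl (artinFun m i j) * inr (gen m i) := by
  rw [← artin_gen_fgen h, inl_aut, map_inv, inv_mul_cancel_right]

/-- The factor by which the `i`-th generator acts on the coset of position `j`. -/
def cosetFactor (m i j : ℕ) : Stab m :=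
  if j < i then inr (gen m (i - 1))
  else if j = i then 1
  else if j = i + 1 then inl (fgen m i)
  else inr (gen m i)

/-- The value of the transposition of `i` and `i + 1` at `j`. -/
def swapFun (i j : ℕ) : ℕ := if j = i then i + 1 else if j = i + 1 then i else j

/-- The action of the `i`-th generator on `Fin (m + 1) × Stab m`. -/
def genAct (i : ℕ) (h : i + 1 < m + 1) : Equiv.Perm (Fin (m + 1) × Stab m) :=
  Equiv.prodShear (Equiv.swap ⟨i, by omega⟩ ⟨i + 1, h⟩) fun j => Equiv.mulLeft (cosetFactor m i j)

theorem genAct_apply (i : ℕ) (h : i + 1 < m + 1) (p : Fin (m + 1) × Stab m) :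
    genAct i h p = (Equiv.swap ⟨i, by omega⟩ ⟨i + 1, h⟩ p.1, cosetFactor m i p.1 * p.2) := rfl

theorem coe_swap_apply (i : ℕ) (h : i + 1 < m + 1) (k : Fin (m + 1)) :
    (Equiv.swap (⟨i, by omega⟩ : Fin (m + 1)) ⟨i + 1, h⟩ k : ℕ) = swapFun i k := by
  simp only [Equiv.swap_apply_def, swapFun, Fin.ext_iff]
  split_ifs <;> rfl

theorem inr_gen_mul_comm {i j : ℕ} (h : i + 2 ≤ j) :
    (inr (gen m i) * inr (gen m j) : Stab m) = inr (gen m j) * inr (gen m i) := by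
  rw [← map_mul, gen_mul_comm h, map_mul]

theorem inr_gen_braid {i : ℕ} (h : i + 2 < m) :
    (inr (gen m i) * inr (gen m (i + 1)) * inr (gen m i) : Stab m) =
      inr (gen m (i + 1)) * inr (gen m i) * inr (gen m (i + 1)) := by
  simp only [← map_mul, gen_braid h]

theorem inr_gen_commute_inl_fgen {i j : ℕ} (h : i + 1 < m) (h₁ : j ≠ i) (h₂ : j ≠ i + 1) :
    (inr (gen m i) * inl (fgen m j) : Stab m) = inl (fgen m j) * inr (gen m i) := by
  rw [inr_gen_mul_inl_fgen h, artinFun, if_neg h₁, if_neg h₂]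

theorem cosetFactor_of_lt {i j : ℕ} (h : j < i) : cosetFactor m i j = inr (gen m (i - 1)) :=
  if_pos h

theorem cosetFactor_self (i : ℕ) : cosetFactor m i i = 1 := by simp [cosetFactor]

theorem cosetFactor_succ (i : ℕ) : cosetFactor m i (i + 1) = inl (fgen m i) := by
  simp [cosetFactor]

theorem cosetFactor_of_gt {i j : ℕ} (h : i + 1 < j) : cosetFactor m i j = inr (gen m i) := by
  simp [cosetFactor, show ¬j < i by omega, show j ≠ i by omega, h.ne']

theorem swapFun_self (i : ℕ) : swapFun i i = i + 1 := if_pos rfl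

theorem swapFun_succ (i : ℕ) : swapFun i (i + 1) = i := by simp [swapFun]

theorem swapFun_of_lt {i j : ℕ} (h : j < i) : swapFun i j = j := by
  simp [swapFun, h.ne, show j ≠ i + 1 by omega]

theorem swapFun_of_gt {i j : ℕ} (h : i + 1 < j) : swapFun i j = j := by
  simp [swapFun, h.ne', show j ≠ i by omega]

theorem cosetFactor_mul_comm {i j k : ℕ} (hij : i + 2 ≤ j) (hj : j < m) :
    cosetFactor m i (swapFun j k) * cosetFactor m j k =
      cosetFactor m j (swapFun i k) * cosetFactor m i k := by
  obtain h | rfl | rfl | ⟨h, h'⟩ | rfl | rfl | h : k < i ∨ k = i ∨ k = i + 1 ∨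
    (i + 1 < k ∧ k < j) ∨ k = j ∨ k = j + 1 ∨ j + 1 < k := by omega
  all_goals
    simp (disch := omega) only [cosetFactor_of_lt, cosetFactor_self, cosetFactor_succ,
      cosetFactor_of_gt, swapFun_self, swapFun_succ, swapFun_of_lt, swapFun_of_gt, one_mul, mul_one]
  · exact inr_gen_mul_comm (by omega)
  · exact (inr_gen_commute_inl_fgen (by omega) (by omega) (by omega)).symm
  · exact inr_gen_mul_comm (by omega)
  · exact inr_gen_commute_inl_fgen (by omega) (by omega) (by omega)
  · exact inr_gen_mul_comm (by omega)

theorem cosetFactor_braid {i k : ℕ} (hi : i + 1 < m) (hk : k < m + 1) :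
    cosetFactor m i (swapFun (i + 1) (swapFun i k)) *
        (cosetFactor m (i + 1) (swapFun i k) * cosetFactor m i k) =
      cosetFactor m (i + 1) (swapFun i (swapFun (i + 1) k)) *
        (cosetFactor m i (swapFun (i + 1) k) * cosetFactor m (i + 1) k) := by
  obtain h | rfl | rfl | rfl | h : k < i ∨ k = i ∨ k = i + 1 ∨ k = i + 1 + 1 ∨ i + 1 + 1 < k := by
    omega
  all_goals
    simp (disch := omega) only [cosetFactor_of_lt, cosetFactor_self, cosetFactor_succ,
      cosetFactor_of_gt, swapFun_self, swapFun_succ, swapFun_of_lt, swapFun_of_gt, one_mul, mul_one,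
      Nat.add_sub_cancel]
  · obtain ⟨i, rfl⟩ : ∃ l, i = l + 1 := ⟨i - 1, by omega⟩
    simpa [mul_assoc] using inr_gen_braid (m := m) (i := i) (by omega)
  · rw [inr_gen_mul_inl_fgen hi, artinFun, if_pos rfl]
  · rw [← mul_assoc (inr _), inr_gen_mul_inl_fgen hi, artinFun, if_pos rfl, mul_assoc (inl _),
      inr_gen_mul_inl_fgen hi, artinFun, if_neg (by omega), if_pos rfl]
    simp [mul_assoc]
  · simpa [mul_assoc] using inr_gen_braid (m := m) (i := i) (by omega)

/-- The action of the braid group on `Fin (m + 1) × Stab m` induced from the left regular action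
of `Stab m`. -/
def monodromy (m : ℕ) : BraidGroup (m + 1) →* Equiv.Perm (Fin (m + 1) × Stab m) :=
  lift genAct
    (by
      intro i j hi hj hij
      ext1 p
      refine Prod.ext ?_ ?_
      · have h := congrArg (perm (m + 1)) (gen_mul_comm (n := m + 1) hij)
        rw [map_mul, map_mul, perm_gen hi, perm_gen hj] at h
        exact DFunLike.congr_fun h p.1
      · simp only [Equiv.Perm.mul_apply, genAct_apply, coe_swap_apply, ← mul_assoc]
        rw [cosetFactor_mul_comm hij (by omega)])
    (by
      intro i hi hj
      ext1 p
      refine Prod.ext ?_ ?_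
      · have h := congrArg (perm (m + 1)) (gen_braid (n := m + 1) hj)
        simp only [map_mul, perm_gen hi, perm_gen hj] at h
        exact DFunLike.congr_fun h p.1
      · simp only [Equiv.Perm.mul_apply, genAct_apply, coe_swap_apply]
        rw [← mul_assoc, ← mul_assoc, mul_assoc (cosetFactor m i _),
          cosetFactor_braid (by omega) p.1.2]
        simp only [mul_assoc])

theorem monodromy_gen {i : ℕ} (h : i + 1 < m + 1) (p : Fin (m + 1) × Stab m) :
    monodromy m (gen (m + 1) i) p =
      (Equiv.swap ⟨i, by omega⟩ ⟨i + 1, h⟩ p.1, cosetFactor m i p.1 * p.2) := by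
  rw [monodromy, lift_gen _ _ _ h, genAct_apply]

theorem monodromy_fst (b : BraidGroup (m + 1)) (p : Fin (m + 1) × Stab m) :
    (monodromy m b p).1 = perm (m + 1) b p.1 := by
  induction b using induction generalizing p with
  | gen i h => rw [monodromy_gen h, perm_gen h]
  | one => simp
  | mul a b ha hb => simp [ha, hb]
  | inv a ha =>
    have h := ha ((monodromy m a)⁻¹ p)
    rw [← Equiv.Perm.mul_apply, mul_inv_cancel, Equiv.Perm.one_apply] at h
    rw [map_inv, map_inv, Equiv.Perm.eq_inv_iff_eq, h]

theorem monodromy_sweep {j : ℕ} (h : j < m + 1) (g : Stab m) :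
    monodromy m (sweep (m + 1) j) (0, g) = (⟨j, h⟩, g) := by
  induction j with
  | zero => simp [sweep]
  | succ j ih =>
    rw [sweep, map_mul, Equiv.Perm.mul_apply, ih (by omega), monodromy_gen h,
      Equiv.swap_apply_left]
    simp [cosetFactor]

theorem monodromy_stabHom (g h : Stab m) : monodromy m (stabHom m g) (0, h) = (0, g * h) := by
  have mul : ∀ g₁ g₂ : Stab m, (∀ h, monodromy m (stabHom m g₁) (0, h) = (0, g₁ * h)) →
      (∀ h, monodromy m (stabHom m g₂) (0, h) = (0, g₂ * h)) →
      ∀ h, monodromy m (stabHom m (g₁ * g₂)) (0, h) = (0, g₁ * g₂ * h) := by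
    intro g₁ g₂ h₁ h₂ h
    rw [map_mul, map_mul, Equiv.Perm.mul_apply, h₂, h₁, mul_assoc]
  have inv : ∀ g : Stab m, (∀ h, monodromy m (stabHom m g) (0, h) = (0, g * h)) →
      ∀ h, monodromy m (stabHom m g⁻¹) (0, h) = (0, g⁻¹ * h) := by
    intro g hg h
    rw [map_inv, map_inv, Equiv.Perm.inv_eq_iff_eq, hg, mul_inv_cancel_left]
  revert h
  rw [← inl_left_mul_inr_right g]
  apply mul
  · generalize g.left = w
    induction w using FreeGroup.induction_on with
    | C1 => simp
    | of j =>
      intro h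
      have hs := monodromy_sweep (m := m) (j := j) (by omega)
      have hs' := monodromy_sweep (m := m) (j := j + 1) (by omega)
      rw [of_eq_fgen, stabHom_inl_fgen j.2, loop, pow_two]
      simp only [map_mul, Equiv.Perm.mul_apply, map_inv, Equiv.Perm.inv_eq_iff_eq, hs]
      rw [monodromy_gen (by omega), monodromy_gen (by omega)]
      simp [cosetFactor]
    | inv_of j hj => rw [map_inv]; exact inv _ hj
    | mul a b ha hb => rw [map_mul]; exact mul _ _ ha hb
  · generalize g.right = b
    induction b using induction with
    | gen i hi =>
      intro h
      rw [stabHom_inr_gen hi, monodromy_gen (by omega), Equiv.swap_apply_of_ne_of_ne]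
      · simp [cosetFactor]
      · simp [Fin.ext_iff]
      · simp [Fin.ext_iff]
    | one => simp
    | inv a ha => rw [map_inv]; exact inv _ ha
    | mul a b ha hb => rw [map_mul]; exact mul _ _ ha hb

theorem stabHom_injective : Function.Injective (stabHom m) := fun g₁ g₂ h => by
  have h₁ := monodromy_stabHom g₁ 1
  rw [h, monodromy_stabHom] at h₁
  simpa using (congrArg Prod.snd h₁).symm

theorem gen_mul_sweep_mul_stabHom {i j : ℕ} (hi : i < m) (hj : j < m + 1) (g : Stab m) :
    gen (m + 1) i * (sweep (m + 1) j * stabHom m g) =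
      sweep (m + 1) (swapFun i j) * stabHom m (cosetFactor m i j * g) := by
  rw [map_mul, ← mul_assoc, ← mul_assoc]
  congr 1
  obtain h | rfl | rfl | h : j < i ∨ j = i ∨ j = i + 1 ∨ i + 1 < j := by omega
  · rw [cosetFactor_of_lt h, swapFun_of_lt h, stabHom_inr_gen (by omega),
      show i - 1 + 1 = i by omega, (gen_commute_sweep h).eq]
  · rw [cosetFactor_self, swapFun_self, map_one, mul_one, sweep]
  · rw [cosetFactor_succ, swapFun_succ, stabHom_inl_fgen hi, loop, sweep, pow_two]
    group
  · rw [cosetFactor_of_gt h, swapFun_of_gt h, stabHom_inr_gen (by omega),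
      gen_mul_sweep h (by omega)]

theorem mul_sweep_mul_stabHom (b : BraidGroup (m + 1)) (p : Fin (m + 1) × Stab m) :
    b * (sweep (m + 1) p.1 * stabHom m p.2) =
      sweep (m + 1) (monodromy m b p).1 * stabHom m (monodromy m b p).2 := by
  induction b using induction generalizing p with
  | gen i h =>
    rw [monodromy_gen h, gen_mul_sweep_mul_stabHom (by omega) p.1.2, coe_swap_apply]
  | one => simp
  | mul a b ha hb => rw [mul_assoc, hb, ha, map_mul, Equiv.Perm.mul_apply]
  | inv a ha =>
    rw [inv_mul_eq_iff_eq_mul, ha, map_inv, ← Equiv.Perm.mul_apply, mul_inv_cancel,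
      Equiv.Perm.one_apply]

theorem exists_stabHom_eq {b : BraidGroup (m + 1)} (hb : perm (m + 1) b 0 = 0) :
    ∃ g, stabHom m g = b := by
  have h := mul_sweep_mul_stabHom b (0, 1)
  rw [monodromy_fst, hb] at h
  exact ⟨_, by simpa [sweep] using h.symm⟩

end BraidGroup

end Monodromy

section Centralizer

namespace BraidGroup

open SemidirectProduct

variable {m : ℕ}

/-- The preimage of a pure braid under `stabHom`. -/
noncomputable def unshift (m : ℕ) : (perm (m + 1)).ker →* Stab m :=
  (MonoidHom.ofInjective stabHom_injective).symm.toMonoidHom.comp <|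
    Subgroup.inclusion (K := (stabHom m).range) fun b (hb : perm (m + 1) b = 1) =>
      exists_stabHom_eq (b := b) (by rw [hb]; rfl)

theorem stabHom_unshift (z : (perm (m + 1)).ker) : stabHom m (unshift m z) = z :=
  MonoidHom.apply_ofInjective_symm stabHom_injective _

theorem unshift_eq_iff {z : (perm (m + 1)).ker} {g : Stab m} :
    unshift m z = g ↔ (z : BraidGroup (m + 1)) = stabHom m g := by
  rw [← stabHom_unshift, stabHom_injective.eq_iff]

theorem unshift_mem_ker (z : (perm (m + 1)).ker) : (unshift m z).right ∈ (perm m).ker := by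
  rw [MonoidHom.mem_ker, ← perm_stabHom_eq_one_iff, stabHom_unshift]
  exact z.2

/-- The homomorphism of pure braid groups forgetting the string in position `0`. -/
noncomputable def forget (m : ℕ) : (perm (m + 1)).ker →* (perm m).ker :=
  (rightHom.comp (unshift m)).codRestrict _ unshift_mem_ker

theorem coe_forget (z : (perm (m + 1)).ker) :
    (forget m z : BraidGroup m) = (unshift m z).right := rfl

theorem stabHom_x₀ (hm : 0 < m) : stabHom m (inl (fgen m 0)) = gen (m + 1) 0 ^ 2 := by
  rw [stabHom_inl_fgen hm]
  simp [loop, sweep]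

theorem stabHom_commute_iff {g h : Stab m} :
    Commute (stabHom m g) (stabHom m h) ↔ Commute g h := by
  simp only [Commute, SemiconjBy, ← map_mul, stabHom_injective.eq_iff]

theorem mem_zpowers_fgen_of_commute {j : ℕ} (hj : j < m) {w : FreeGroup (Fin m)}
    (hw : Commute w (fgen m j)) : w ∈ Subgroup.zpowers (fgen m j) := by
  rw [fgen_eq_of hj] at *
  exact FreeGroup.mem_zpowers_of_commute_of hw

theorem commute_inl_iff {g : Stab m} {w : FreeGroup (Fin m)} :
    Commute g (inl w) ↔ g.left * artin m g.right w = w * g.left := by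
  rw [Commute, SemiconjBy, SemidirectProduct.ext_iff]
  simp

theorem inl_eq_of_right_eq_one {g : Stab m} (hg : g.right = 1) : inl g.left = g := by
  rw [SemidirectProduct.ext_iff]
  simp [hg]

theorem exists_commute_gen_zero_sq (hm : 0 < m) (p : (perm m).ker) :
    ∃ b : (perm (m + 1)).ker, Commute (b : BraidGroup (m + 1)) (gen (m + 1) 0 ^ 2) ∧
      forget m b = p := by
  obtain ⟨u, hu⟩ := exists_artin_of_eq p.2 ⟨0, hm⟩
  let g : Stab m := ⟨u⁻¹, p⟩
  refine ⟨⟨stabHom m g, (perm_stabHom_eq_one_iff g).2 p.2⟩, ?_, ?_⟩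
  · rw [← stabHom_x₀ hm]
    change Commute (stabHom m g) _
    rw [stabHom_commute_iff, commute_inl_iff, fgen_eq_of hm, hu]
    simp [g, mul_assoc]
  · ext1
    rw [coe_forget, unshift_eq_iff.2 rfl]

theorem mem_zpowers_of_forget_eq_one (hm : 0 < m) {b : (perm (m + 1)).ker}
    (hb : Commute (b : BraidGroup (m + 1)) (gen (m + 1) 0 ^ 2)) (h : forget m b = 1) :
    (b : BraidGroup (m + 1)) ∈ Subgroup.zpowers (gen (m + 1) 0 ^ 2) := by
  have hr : (unshift m b).right = 1 := congrArg Subtype.val h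
  rw [← stabHom_x₀ hm, ← stabHom_unshift, stabHom_commute_iff, commute_inl_iff, hr] at hb
  obtain ⟨k, hk⟩ := mem_zpowers_fgen_of_commute hm (by simpa [Commute, SemiconjBy] using hb)
  refine ⟨k, ?_⟩
  simp only at hk ⊢
  rw [← stabHom_x₀ hm, ← stabHom_unshift, ← inl_eq_of_right_eq_one hr, ← hk, map_zpow, map_zpow]

/-- The braid `σ_0 σ_1`, conjugating `σ_0` to `σ_1`. -/
def conjBraid (n : ℕ) : BraidGroup n := gen n 0 * gen n 1

theorem conjBraid_conj (hm : 1 < m) :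
    gen (m + 1) 1 ^ 2 =
      MulAut.conj (conjBraid (m + 1)) (gen (m + 1) 0 ^ 2) := by
  rw [map_pow]
  congr 1
  rw [MulAut.conj_apply, eq_mul_inv_iff_mul_eq, conjBraid, gen_braid (by omega), mul_assoc]

/-- The homomorphism of pure braid groups forgetting the string in position `1`. -/
noncomputable def forget₁ (m : ℕ) : (perm (m + 1)).ker →* (perm m).ker :=
  (forget m).comp (MulAut.conjNormal (conjBraid (m + 1)))⁻¹.toMonoidHom

theorem conj_conjNormal_inv (c : BraidGroup m) (b : (perm m).ker) :
    MulAut.conj c ((MulAut.conjNormal c)⁻¹ b : (perm m).ker) = (b : BraidGroup m) := by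
  simp [mul_assoc]

theorem commute_gen_one_sq_iff (hm : 1 < m) {b : (perm (m + 1)).ker} :
    Commute (b : BraidGroup (m + 1)) (gen (m + 1) 1 ^ 2) ↔
      Commute (((MulAut.conjNormal (conjBraid (m + 1)))⁻¹ b : (perm (m + 1)).ker) :
        BraidGroup (m + 1)) (gen (m + 1) 0 ^ 2) := by
  rw [← conj_conjNormal_inv (conjBraid (m + 1)) b, conjBraid_conj hm]
  simp only [Commute, SemiconjBy, ← map_mul, (MulAut.conj _).injective.eq_iff]

theorem exists_commute_gen_one_sq (hm : 1 < m) (p : (perm m).ker) :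
    ∃ b : (perm (m + 1)).ker, Commute (b : BraidGroup (m + 1)) (gen (m + 1) 1 ^ 2) ∧
      forget₁ m b = p := by
  obtain ⟨b, hb, rfl⟩ := exists_commute_gen_zero_sq (by omega) p
  refine ⟨MulAut.conjNormal (conjBraid (m + 1)) b, ?_, ?_⟩
  · rwa [commute_gen_one_sq_iff hm, MulAut.inv_apply_self]
  · exact congrArg (forget m) (MulAut.inv_apply_self _ _ _)

theorem mem_zpowers_of_forget₁_eq_one (hm : 1 < m) {b : (perm (m + 1)).ker}
    (hb : Commute (b : BraidGroup (m + 1)) (gen (m + 1) 1 ^ 2)) (h : forget₁ m b = 1) :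
    (b : BraidGroup (m + 1)) ∈ Subgroup.zpowers (gen (m + 1) 1 ^ 2) := by
  obtain ⟨k, hk⟩ := mem_zpowers_of_forget_eq_one (by omega) ((commute_gen_one_sq_iff hm).1 hb) h
  refine ⟨k, ?_⟩
  simp only at hk ⊢
  rw [conjBraid_conj hm, ← map_zpow, hk, conj_conjNormal_inv]

theorem artin_gen_one_sq_fgen {j : ℕ} (hm : 2 < m) (hj : j = 1 ∨ j = 2) :
    artin m (gen m 1 ^ 2) (fgen m j) =
      (fgen m 1 * fgen m 2)⁻¹ * fgen m j * (fgen m 1 * fgen m 2) := by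
  rcases hj with rfl | rfl <;>
    simp [pow_two, artin_gen_fgen (show 1 + 1 < m from hm), artinFun, mul_assoc]

theorem artin_gen_one_sq_fgen_of_ne {j : ℕ} (hm : 2 < m) (h₁ : j ≠ 1) (h₂ : j ≠ 2) :
    artin m (gen m 1 ^ 2) (fgen m j) = fgen m j := by
  simp [pow_two, artin_gen_fgen (show 1 + 1 < m from hm), artinFun, h₁, h₂]

theorem commute_inr_gen_one_sq (hm : 2 < m) :
    Commute (inr (gen m 1 ^ 2) : Stab m) (inl (fgen m 0)) := by
  rw [commute_inl_iff, left_inr, right_inr,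
    artin_gen_one_sq_fgen_of_ne hm (by omega) (by omega), one_mul, mul_one]

theorem commute_inr_iff {w : FreeGroup (Fin m)} {a b : BraidGroup m} (h : Commute a b) :
    Commute (⟨w, b⟩ : Stab m) (inr a) ↔ artin m a w = w := by
  rw [Commute, SemiconjBy, SemidirectProduct.ext_iff]
  simp [h.eq, eq_comm]

/-- A pure braid commuting with `σ_1 ^ 2` lifts to the centralizer of both factors. -/
theorem exists_right_eq_and_commute (hm : 2 < m) {b : BraidGroup m} (hb : perm m b = 1)
    (hc : Commute b (gen m 1 ^ 2)) :
    ∃ g : Stab m, g.right = b ∧ Commute g (inl (fgen m 0)) ∧ Commute g (inr (gen m 1 ^ 2)) := by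
  obtain ⟨u, hu⟩ := exists_artin_of_eq hb ⟨0, by omega⟩
  have ha : perm m (gen m 1 ^ 2) = 1 := by
    rw [map_pow, perm_gen (show 1 + 1 < m from hm), pow_two, Equiv.swap_mul_self]
  rw [← fgen_eq_of] at hu
  have hx := artin_gen_one_sq_fgen_of_ne hm (show 0 ≠ 1 by omega) (show 0 ≠ 2 by omega)
  have hau : artin m (gen m 1 ^ 2) u = u := by
    have h := congrArg (artin m (gen m 1 ^ 2)) hu
    rw [← MulAut.mul_apply, ← map_mul, ← hc.eq, map_mul, MulAut.mul_apply, hx, hu, map_mul,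
      map_mul, hx, map_inv] at h
    set v := artin m (gen m 1 ^ 2) u with hv
    have hcomm : Commute (u⁻¹ * v) (fgen m 0) := by
      rw [Commute, SemiconjBy, mul_assoc, inv_mul_eq_iff_eq_mul, ← mul_assoc, ← mul_assoc,
        ← mul_inv_eq_iff_eq_mul, ← h]
    obtain ⟨k, hk⟩ := mem_zpowers_fgen_of_commute (by omega) hcomm
    have hf := congrArg (fexp ⟨0, by omega⟩) hk
    simp only [map_zpow, map_mul, map_inv, hv, fexp_artin ha, fgen_eq_of (show 0 < m by omega),
      fexp_of_self, inv_mul_cancel, ← ofAdd_zsmul, ofAdd_eq_one] at hf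
    obtain rfl : k = 0 := by simpa using hf
    simpa [eq_inv_mul_iff_mul_eq, eq_comm] using hk
  refine ⟨⟨u⁻¹, b⟩, rfl, ?_, ?_⟩
  · rw [commute_inl_iff, hu]
    simp [mul_assoc]
  · rw [commute_inr_iff hc.symm, map_inv, hau]

theorem mem_zpowers_of_commute_mul_inv (hm : 2 < m) {w : FreeGroup (Fin m)}
    (hw : Commute (inl w : Stab m) (inl (fgen m 0) * (inr (gen m 1 ^ 2))⁻¹)) :
    w ∈ Subgroup.zpowers (fgen m 0) := by
  have h₁ : w * (fgen m 0)⁻¹ = (fgen m 0)⁻¹ * artin m (gen m 1 ^ 2) w := by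
    have h := hw.inv_right
    rw [mul_inv_rev, inv_inv, (commute_inr_gen_one_sq hm).inv_right.eq] at h
    have h' := congrArg SemidirectProduct.left h.eq
    simpa [mul_assoc, -map_pow] using h'
  let p : Fin m → Bool := fun j => decide ((j : ℕ) ≠ 1 ∧ (j : ℕ) ≠ 2)
  have h_true : ∀ j, p j = true → artin m (gen m 1 ^ 2) (FreeGroup.of j) = FreeGroup.of j := by
    intro j hj
    obtain ⟨h₁, h₂⟩ := of_decide_eq_true hj
    rw [of_eq_fgen, artin_gen_one_sq_fgen_of_ne hm h₁ h₂]
  obtain ⟨v, rfl⟩ := FreeGroup.mem_range_map_of_mul_eq p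
    (ψ := (artin m (gen m 1 ^ 2)).toMonoidHom)
    (FreeGroup.of ⟨⟨1, by omega⟩, by simp [p]⟩ * FreeGroup.of ⟨⟨2, hm⟩, by simp [p]⟩) h_true
    (fun j hj => by
      have hj' : (j : ℕ) = 1 ∨ (j : ℕ) = 2 := by
        have := of_decide_eq_false hj
        omega
      rw [of_eq_fgen, MulEquiv.coe_toMonoidHom, artin_gen_one_sq_fgen hm hj']
      simp [of_eq_fgen])
    (x := (FreeGroup.of ⟨⟨0, by omega⟩, by simp [p]⟩)⁻¹) (by simp) (w := w)
    (by simpa [of_eq_fgen] using h₁)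
  have hfix : (artin m (gen m 1 ^ 2)).toMonoidHom.comp (FreeGroup.map Subtype.val) =
      FreeGroup.map (Subtype.val : {j // p j = true} → Fin m) := by
    ext j
    simpa [-map_pow] using h_true j j.2
  have hv := DFunLike.congr_fun hfix v
  simp only [MonoidHom.comp_apply, MulEquiv.coe_toMonoidHom] at hv
  rw [hv] at h₁
  exact mem_zpowers_fgen_of_commute (by omega) (Commute.inv_right_iff.1 h₁)

/-- The linking number of the strings in positions `0` and `1`. -/
noncomputable def linking (hm : 0 < m) : (perm (m + 1)).ker →* Multiplicative ℤ :=
  MonoidHom.mk' (fun z => fexp ⟨0, hm⟩ (unshift m z).left) fun z₁ z₂ => by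
    rw [map_mul, mul_left, map_mul, fexp_artin (unshift_mem_ker z₁)]

theorem linking_apply (hm : 0 < m) (z : (perm (m + 1)).ker) :
    linking hm z = fexp ⟨0, hm⟩ (unshift m z).left := rfl

theorem gen_sq_mem_ker {n i : ℕ} (h : i + 1 < n) : gen n i ^ 2 ∈ (perm n).ker := by
  rw [MonoidHom.mem_ker, map_pow, perm_gen h, pow_two, Equiv.swap_mul_self]

theorem expSum_gen_sq {n i : ℕ} (h : i + 1 < n) :
    expSum n (gen n i ^ 2) = Multiplicative.ofAdd 2 := by
  rw [map_pow, expSum_gen h]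
  rfl

theorem unshift_gen_zero_sq (hm : 0 < m) :
    unshift m ⟨gen (m + 1) 0 ^ 2, gen_sq_mem_ker (by omega)⟩ = inl (fgen m 0) :=
  unshift_eq_iff.2 (stabHom_x₀ hm).symm

theorem unshift_gen_succ_sq {i : ℕ} (h : i + 1 < m) :
    unshift m ⟨gen (m + 1) (i + 1) ^ 2, gen_sq_mem_ker (by omega)⟩ = inr (gen m i ^ 2) :=
  unshift_eq_iff.2 (by rw [map_pow, map_pow, stabHom_inr_gen h])

theorem commute_gen_sq_mul_inv_iff (hm : 2 < m) {g : Stab m} :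
    Commute (stabHom m g) (gen (m + 1) 0 ^ 2 * (gen (m + 1) 2 ^ 2)⁻¹) ↔
      Commute g (inl (fgen m 0) * (inr (gen m 1 ^ 2))⁻¹) := by
  rw [← stabHom_commute_iff, map_mul, stabHom_x₀ (by omega), map_inv, map_pow, map_pow,
    stabHom_inr_gen (show 1 + 1 < m from hm)]

theorem forget₁_gen_one_sq (hm : 1 < m) :
    forget₁ m ⟨gen (m + 1) 1 ^ 2, gen_sq_mem_ker (by omega)⟩ = 1 := by
  have h : (MulAut.conjNormal (conjBraid (m + 1)))⁻¹
      (⟨gen (m + 1) 1 ^ 2, gen_sq_mem_ker (by omega)⟩ : (perm (m + 1)).ker) =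
      ⟨gen (m + 1) 0 ^ 2, gen_sq_mem_ker (by omega)⟩ := by
    ext1
    apply (MulAut.conj (conjBraid (m + 1))).injective
    rw [conj_conjNormal_inv, ← conjBraid_conj hm]
  ext1
  refine (congrArg (fun z => (unshift m z).right) h).trans ?_
  simp only [unshift_gen_zero_sq (show 0 < m by omega), right_inl]
  rfl

theorem eq_one_of_forget_eq_one (hm : 1 < m) {z : (perm (m + 1 + 1)).ker}
    (hc : Commute (z : BraidGroup (m + 1 + 1))
      (gen (m + 1 + 1) 0 ^ 2 * (gen (m + 1 + 1) 2 ^ 2)⁻¹))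
    (hf : forget₁ m (forget (m + 1) z) = 1) (hl : linking (Nat.succ_pos m) z = 1)
    (he : expSum _ (z : BraidGroup (m + 1 + 1)) = 1) : z = 1 := by
  have hm' : 2 < m + 1 := by omega
  rw [linking_apply] at hl
  rw [← stabHom_unshift] at he
  rw [← stabHom_unshift, commute_gen_sq_mul_inv_iff hm'] at hc
  have hc' : Commute (unshift (m + 1) z).right (gen (m + 1) 1 ^ 2) := by
    have h := hc.inv_right.map (rightHom (φ := artin (m + 1)))
    simpa [-map_pow] using h
  obtain ⟨j, hj⟩ := mem_zpowers_of_forget₁_eq_one hm hc' hf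
  rw [coe_forget] at hj
  simp only at hj
  suffices h : unshift (m + 1) z = 1 by
    ext1
    rw [← stabHom_unshift, h, map_one]
    rfl
  generalize unshift (m + 1) z = g at *
  have hg : inl (g * inr (gen (m + 1) 1 ^ 2) ^ (-j)).left =
      g * inr (gen (m + 1) 1 ^ 2) ^ (-j) :=
    inl_eq_of_right_eq_one (by
      rw [mul_right, ← map_zpow, right_inr, ← hj]
      simp)
  have hy : Commute (inr (gen (m + 1) 1 ^ 2) : Stab (m + 1))
      (inl (fgen (m + 1) 0) * (inr (gen (m + 1) 1 ^ 2))⁻¹) :=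
    (commute_inr_gen_one_sq hm').mul_right (Commute.refl _).inv_right
  obtain ⟨i, hi⟩ := mem_zpowers_of_commute_mul_inv hm'
    (w := (g * inr (gen (m + 1) 1 ^ 2) ^ (-j)).left)
    (by rw [hg]; exact hc.mul_left (hy.zpow_left _))
  simp only at hi
  have hleft : g.left = fgen (m + 1) 0 ^ i := by
    rw [hi, ← map_zpow, mul_left, left_inr, map_one, mul_one]
  rw [hleft, fgen_eq_of (Nat.succ_pos m), map_zpow, fexp_of_self] at hl
  obtain rfl : i = 0 := by simpa [← ofAdd_zsmul] using hl
  have hg' : g = inr (gen (m + 1) 1 ^ 2) ^ j := by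
    rw [← inl_left_mul_inr_right g, hleft, ← hj]
    simp
  rw [hg', map_zpow, map_pow, map_pow, stabHom_inr_gen hm', map_zpow,
    expSum_gen_sq (by omega)] at he
  obtain rfl : j = 0 := by simpa [← ofAdd_zsmul] using he
  rw [hg', zpow_zero]

theorem exists_forget_eq (hm : 1 < m) (p : (perm m).ker) (l : Multiplicative ℤ) :
    ∃ z : (perm (m + 1 + 1)).ker, Commute (z : BraidGroup (m + 1 + 1))
      (gen (m + 1 + 1) 0 ^ 2 * (gen (m + 1 + 1) 2 ^ 2)⁻¹) ∧
    forget₁ m (forget (m + 1) z) = p ∧ linking (Nat.succ_pos m) z = l ∧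
    expSum _ (z : BraidGroup (m + 1 + 1)) = 1 := by
  have hm' : 2 < m + 1 := by omega
  obtain ⟨b, hb, rfl⟩ := exists_commute_gen_one_sq hm p
  obtain ⟨g, hgb, hgx, hgy⟩ := exists_right_eq_and_commute hm' b.2 hb
  let z : (perm (m + 1 + 1)).ker :=
    ⟨stabHom (m + 1) g, (perm_stabHom_eq_one_iff g).2 (by rw [hgb]; exact b.2)⟩
  let x : (perm (m + 1 + 1)).ker := ⟨gen (m + 1 + 1) 0 ^ 2, gen_sq_mem_ker (by omega)⟩
  let y : (perm (m + 1 + 1)).ker := ⟨gen (m + 1 + 1) 2 ^ 2, gen_sq_mem_ker (by omega)⟩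
  have hux : unshift (m + 1) x = inl (fgen (m + 1) 0) := unshift_gen_zero_sq (Nat.succ_pos m)
  have huy : unshift (m + 1) y = inr (gen (m + 1) 1 ^ 2) := unshift_gen_succ_sq hm'
  have hz : forget (m + 1) z = b := by
    ext1
    rw [coe_forget, unshift_eq_iff.2 rfl, hgb]
  have hx : forget (m + 1) x = 1 := by
    ext1
    rw [coe_forget, hux, right_inl]
    rfl
  have hy : forget (m + 1) y = ⟨gen (m + 1) 1 ^ 2, gen_sq_mem_ker hm'⟩ := by
    ext1
    rw [coe_forget, huy, right_inr]
  have hlx : linking (Nat.succ_pos m) x = Multiplicative.ofAdd 1 := by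
    rw [linking_apply, hux, left_inl, fgen_eq_of (Nat.succ_pos m), fexp_of_self]
  have hly : linking (Nat.succ_pos m) y = 1 := by
    rw [linking_apply, huy, left_inr, map_one]
  have hcy := commute_inr_gen_one_sq hm'
  obtain ⟨r, hr⟩ := even_expSum z.2
  obtain ⟨i, hi⟩ : ∃ i : ℤ, linking (Nat.succ_pos m) z * Multiplicative.ofAdd i = l :=
    ⟨Multiplicative.toAdd ((linking (Nat.succ_pos m) z)⁻¹ * l), by simp⟩
  refine ⟨z * x ^ i * y ^ (-r - i), ?_, ?_, ?_, ?_⟩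
  · rw [← stabHom_unshift, commute_gen_sq_mul_inv_iff hm', map_mul, map_mul, map_zpow, map_zpow,
      hux, huy, unshift_eq_iff.2 (rfl : (z : BraidGroup _) = stabHom (m + 1) g)]
    exact ((hgx.mul_right hgy.inv_right).mul_left
      (((Commute.refl _).mul_right hcy.symm.inv_right).zpow_left i)).mul_left
      ((hcy.mul_right (Commute.refl _).inv_right).zpow_left _)
  · simp only [map_mul, map_zpow, hz, hx, hy, map_one, forget₁_gen_one_sq hm]
    simp
  · rw [map_mul, map_mul, map_zpow, map_zpow, hlx, hly, one_zpow, mul_one, ← ofAdd_zsmul,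
      smul_eq_mul, mul_one, hi]
  · have hr' : expSum _ (z : BraidGroup (m + 1 + 1)) = Multiplicative.ofAdd (r + r) := hr
    simp only [Subgroup.coe_mul, Subgroup.coe_zpow, map_mul, map_zpow, hr', x, y]
    rw [expSum_gen_sq (by omega), expSum_gen_sq (by omega), ← ofAdd_zsmul, ← ofAdd_zsmul,
      ← ofAdd_add, ← ofAdd_add, ofAdd_eq_one]
    simp only [smul_eq_mul]
    ring

theorem nonempty_centralizer_mulEquiv (hm : 1 < m) :
    Nonempty (↥(Subgroup.centralizer {gen (m + 2) 0 ^ 2 * (gen (m + 2) 2 ^ 2)⁻¹} ⊓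
      commutator (BraidGroup (m + 2)) ⊓ (perm (m + 2)).ker) ≃*
        ↥(perm m).ker × Multiplicative ℤ) := by
  let f : (perm (m + 2)).ker →* (perm m).ker × Multiplicative ℤ :=
    ((forget₁ m).comp (forget (m + 1))).prod (linking (Nat.succ_pos m))
  refine ⟨MulEquiv.ofBijective (f.comp (Subgroup.inclusion inf_le_right)) ⟨?_, ?_⟩⟩
  · rw [injective_iff_map_eq_one]
    rintro ⟨z, ⟨hz, he⟩, hp⟩ hf
    rw [← ker_expSum] at he
    have h := eq_one_of_forget_eq_one hm (z := ⟨z, hp⟩)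
      (Subgroup.mem_centralizer_singleton_iff.1 hz) (congrArg Prod.fst hf) (congrArg Prod.snd hf) he
    exact Subtype.ext (congrArg (fun w : (perm (m + 2)).ker => (w : BraidGroup (m + 2))) h)
  · rintro ⟨p, l⟩
    obtain ⟨z, hz, hp, hl, he⟩ := exists_forget_eq hm p l
    refine ⟨⟨z, ⟨Subgroup.mem_centralizer_singleton_iff.2 hz, ?_⟩, z.2⟩, Prod.ext hp hl⟩
    rw [← ker_expSum]
    exact he

theorem eq_perm {n : ℕ} {μ : BraidGroup n →* Equiv.Perm (Fin n)}
    (hμ : ∀ i : Fin (n - 1), μ (σ i) =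
      Equiv.swap ⟨(i : ℕ), by have := i.isLt; omega⟩ ⟨(i : ℕ) + 1, by have := i.isLt; omega⟩) :
    μ = perm n :=
  hom_ext fun i hi => by rw [perm_gen hi, gen_eq_σ hi, hμ]

end BraidGroup

end Centralizer

/-- For `n ≥ 4`, the centralizer of `σ₁²σ₃⁻²` in `J_n = B'_n ∩ P_n` is isomorphic to
`P_{n-2} × ℤ`, where `P_{n-2}` is the pure braid group on `n-2` strings
(the kernel of `μ' : B_{n-2} → S_{n-2}`). -/
theorem centralizer_in_Jn (n : ℕ) (hn : 4 ≤ n)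
    (μ : BraidGroup n →* Equiv.Perm (Fin n))
    (hμ : ∀ i : Fin (n - 1), μ (σ i) =
      Equiv.swap ⟨(i : ℕ), by have := i.isLt; omega⟩ ⟨(i : ℕ) + 1, by have := i.isLt; omega⟩)
    (μ' : BraidGroup (n - 2) →* Equiv.Perm (Fin (n - 2)))
    (hμ' : ∀ i : Fin (n - 2 - 1), μ' (σ i) =
      Equiv.swap ⟨(i : ℕ), by have := i.isLt; omega⟩ ⟨(i : ℕ) + 1, by have := i.isLt; omega⟩) :
    Nonempty
      (↥(Subgroup.centralizer {σ ⟨0, by omega⟩ ^ 2 * ((σ ⟨2, by omega⟩ : BraidGroup n) ^ 2)⁻¹} ⊓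
          commutator (BraidGroup n) ⊓ μ.ker) ≃*
        ↥μ'.ker × Multiplicative ℤ) := by
  obtain ⟨k, rfl⟩ := Nat.exists_eq_add_of_le' hn
  obtain rfl := BraidGroup.eq_perm hμ
  obtain rfl := BraidGroup.eq_perm hμ'
  have h := BraidGroup.nonempty_centralizer_mulEquiv (m := k + 2) (by omega)
  rwa [BraidGroup.gen_eq_σ (by omega), BraidGroup.gen_eq_σ (by omega)] at h
end

section
/- In B_4 let c = σ_3σ_1^{−1} and d = σ_1³σ_3³Δ^{−1} (both lie in B'_4). The centralizer Z(d²; B'_4) of d² in B'_4 is the semidirect product of the infinite cyclic groups ⟨c⟩ and ⟨d⟩, where d acts on ⟨c⟩ by dcd^{−1} = c^{−1}; equivalently, c and d have infinite order, dcd^{−1} = c^{−1}, and the map ℤ × ℤ → Z(d²; B'_4), (m,k) ↦ c^m d^k, is a bijection. -/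
/-- Garside's half twist `Δ₄ = σ₁σ₂σ₃σ₁σ₂σ₁ ∈ B_4` (0-based indices). -/
def Δ4 : BraidGroup 4 :=
  σ ⟨0, by omega⟩ * σ ⟨1, by omega⟩ * σ ⟨2, by omega⟩ *
    σ ⟨0, by omega⟩ * σ ⟨1, by omega⟩ * σ ⟨0, by omega⟩

/-- `c = σ₃σ₁⁻¹ ∈ B_4` (0-based indices). -/
def c4 : BraidGroup 4 := σ ⟨2, by omega⟩ * (σ ⟨0, by omega⟩)⁻¹

/-- `d = σ₁³σ₃³Δ⁻¹ ∈ B_4` (0-based indices). -/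
def d4 : BraidGroup 4 := σ ⟨0, by omega⟩ ^ 3 * σ ⟨2, by omega⟩ ^ 3 * Δ4⁻¹

section FreeGroupRankTwo

open FreeGroup (of)

/-- The automorphism `a ↦ a`, `b ↦ a⁻¹ b` of the free group on `a = of true`, `b = of false`. -/
def freeShear : MulAut (FreeGroup Bool) :=
  MonoidHom.toMulEquiv
    (FreeGroup.lift fun i => if i then of true else (of true)⁻¹ * of false)
    (FreeGroup.lift fun i => if i then of true else of true * of false)
    (by ext i; cases i <;> simp) (by ext i; cases i <;> simp)

/-- The automorphism `a ↦ b`, `b ↦ b a⁻¹ b` of the free group on `a = of true`, `b = of false`. -/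
def freeTurn : MulAut (FreeGroup Bool) :=
  MonoidHom.toMulEquiv
    (FreeGroup.lift fun i => if i then of false else of false * (of true)⁻¹ * of false)
    (FreeGroup.lift fun i => if i then of true * (of false)⁻¹ * of true else of true)
    (by ext i; cases i <;> simp [mul_assoc]) (by ext i; cases i <;> simp [mul_assoc])

@[simp] theorem freeShear_true : freeShear (of true) = of true := by
  simp [freeShear, MonoidHom.toMulEquiv]

@[simp] theorem freeShear_false : freeShear (of false) = (of true)⁻¹ * of false := by
  simp [freeShear, MonoidHom.toMulEquiv]

@[simp] theorem freeTurn_true : freeTurn (of true) = of false := by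
  simp [freeTurn, MonoidHom.toMulEquiv]

@[simp] theorem freeTurn_false :
    freeTurn (of false) = of false * (of true)⁻¹ * of false := by
  simp [freeTurn, MonoidHom.toMulEquiv]

theorem freeAut_ext {τ τ' : MulAut (FreeGroup Bool)} (ht : τ (of true) = τ' (of true))
    (hf : τ (of false) = τ' (of false)) : τ = τ' := by
  have h : τ.toMonoidHom = τ'.toMonoidHom := by
    ext i; cases i
    · exact hf
    · exact ht
  ext w
  exact DFunLike.congr_fun h w

theorem freeShear_freeTurn_braid :
    freeShear * freeTurn * freeShear = freeTurn * freeShear * freeTurn := by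
  apply freeAut_ext <;> simp [mul_assoc]

theorem freeShear_pow_false (n : ℕ) :
    (freeShear ^ n) (of false) = (of true) ^ (-n : ℤ) * of false := by
  induction n with
  | zero => simp
  | succ n ih =>
    rw [pow_succ', MulAut.mul_apply, ih]
    simp only [map_mul, map_zpow, freeShear_true, freeShear_false, Nat.cast_succ]
    group

theorem freeShear_pow_true (n : ℕ) : (freeShear ^ n) (of true) = of true := by
  induction n with
  | zero => simp
  | succ n ih => rw [pow_succ', MulAut.mul_apply, ih, freeShear_true]

/-- `LeadsWith ε u` says that the reduced form of `u` starts with `b ^ ε`, for `ε = ±1`. -/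
inductive LeadsWith : ℤ → FreeGroup Bool → Prop
  | base (ε n : ℤ) (hε : ε = 1 ∨ ε = -1) : LeadsWith ε (of false ^ ε * of true ^ n)
  | step (ε δ n : ℤ) (u : FreeGroup Bool) (hε : ε = 1 ∨ ε = -1) (hu : LeadsWith δ u)
      (hn : n = 0 → ε = δ) : LeadsWith ε (of false ^ ε * of true ^ n * u)

theorem LeadsWith.sign {ε : ℤ} {u : FreeGroup Bool} (h : LeadsWith ε u) : ε = 1 ∨ ε = -1 := by
  cases h <;> assumption

theorem LeadsWith.exists_zpow_mul {ε : ℤ} (hε : ε = 1 ∨ ε = -1) (w : FreeGroup Bool)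
    (h : (∃ n : ℤ, w = of true ^ n) ∨ ∃ (n ε : ℤ) (u : FreeGroup Bool), LeadsWith ε u ∧ w = of true ^ n * u) :
    (∃ n : ℤ, of false ^ ε * w = of true ^ n) ∨
      ∃ (n ε' : ℤ) (u : FreeGroup Bool), LeadsWith ε' u ∧ of false ^ ε * w = of true ^ n * u := by
  obtain ⟨n, rfl⟩ | ⟨n, δ, u, hu, rfl⟩ := h
  · exact Or.inr ⟨0, ε, _, .base ε n hε, by simp⟩
  · by_cases hn : n = 0 → ε = δ
    · exact Or.inr ⟨0, ε, _, .step ε δ n u hε hu hn, by simp [mul_assoc]⟩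
    · push Not at hn
      obtain ⟨rfl, hne⟩ := hn
      have hδ : δ = -ε := by have := hu.sign; omega
      cases hu with
      | base _ m _ => exact Or.inl ⟨m, by simp [hδ]⟩
      | step _ δ' m v _ hv _ => exact Or.inr ⟨m, δ', v, hv, by simp [hδ, mul_assoc]⟩

theorem exists_leadsWith (w : FreeGroup Bool) :
    (∃ n : ℤ, w = of true ^ n) ∨ ∃ (n ε : ℤ) (u : FreeGroup Bool), LeadsWith ε u ∧ w = of true ^ n * u := by
  have hw : w ∈ Subgroup.closure (Set.range (of : Bool → FreeGroup Bool)) := by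
    rw [FreeGroup.closure_range_of]; trivial
  have htrue : ∀ (k : ℤ) (w : FreeGroup Bool),
      ((∃ n : ℤ, w = of true ^ n) ∨ ∃ (n ε : ℤ) (u : FreeGroup Bool), LeadsWith ε u ∧ w = of true ^ n * u) →
      (∃ n : ℤ, of true ^ k * w = of true ^ n) ∨
        ∃ (n ε : ℤ) (u : FreeGroup Bool), LeadsWith ε u ∧ of true ^ k * w = of true ^ n * u := by
    rintro k w (⟨n, rfl⟩ | ⟨n, ε, u, hu, rfl⟩)
    · exact Or.inl ⟨k + n, by rw [zpow_add]⟩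
    · exact Or.inr ⟨k + n, ε, u, hu, by rw [zpow_add, mul_assoc]⟩
  induction hw using Subgroup.closure_induction_left with
  | one => exact Or.inl ⟨0, by simp⟩
  | mul_left x hx y _ ih =>
    obtain ⟨i, rfl⟩ := hx
    cases i
    · simpa using LeadsWith.exists_zpow_mul (Or.inl rfl) y ih
    · simpa using htrue 1 y ih
  | inv_mul_cancel x hx y _ ih =>
    obtain ⟨i, rfl⟩ := hx
    cases i
    · simpa using LeadsWith.exists_zpow_mul (Or.inr rfl) y ih
    · simpa using htrue (-1) y ih

/-- The upper unipotent matrix with off-diagonal entry `n`. -/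
def upperUnipotent (n : ℤ) : Matrix.SpecialLinearGroup (Fin 2) ℤ :=
  ⟨!![1, n; 0, 1], by simp [Matrix.det_fin_two]⟩

/-- The lower unipotent matrix with off-diagonal entry `n`. -/
def lowerUnipotent (n : ℤ) : Matrix.SpecialLinearGroup (Fin 2) ℤ :=
  ⟨!![1, 0; n, 1], by simp [Matrix.det_fin_two]⟩

@[simp] theorem coe_upperUnipotent (n : ℤ) :
    (upperUnipotent n : Matrix (Fin 2) (Fin 2) ℤ) = !![1, n; 0, 1] := rfl

@[simp] theorem coe_lowerUnipotent (n : ℤ) :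
    (lowerUnipotent n : Matrix (Fin 2) (Fin 2) ℤ) = !![1, 0; n, 1] := rfl

theorem upperUnipotent_mul (m n : ℤ) :
    upperUnipotent m * upperUnipotent n = upperUnipotent (m + n) := by
  ext i j
  fin_cases i <;> fin_cases j <;>
    simp [Matrix.mul_apply, Fin.sum_univ_two, add_comm]

theorem lowerUnipotent_mul (m n : ℤ) :
    lowerUnipotent m * lowerUnipotent n = lowerUnipotent (m + n) := by
  ext i j
  fin_cases i <;> fin_cases j <;>
    simp [Matrix.mul_apply, Fin.sum_univ_two]

theorem upperUnipotent_zero : upperUnipotent 0 = 1 := by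
  ext i j
  fin_cases i <;> fin_cases j <;> simp

theorem lowerUnipotent_zero : lowerUnipotent 0 = 1 := by
  ext i j
  fin_cases i <;> fin_cases j <;> simp

/-- `upperUnipotent` as a homomorphism from the additive group of integers. -/
def upperHom : Multiplicative ℤ →* Matrix.SpecialLinearGroup (Fin 2) ℤ where
  toFun n := upperUnipotent n.toAdd
  map_one' := upperUnipotent_zero
  map_mul' _ _ := (upperUnipotent_mul _ _).symm

/-- `lowerUnipotent` as a homomorphism from the additive group of integers. -/
def lowerHom : Multiplicative ℤ →* Matrix.SpecialLinearGroup (Fin 2) ℤ where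
  toFun n := lowerUnipotent n.toAdd
  map_one' := lowerUnipotent_zero
  map_mul' _ _ := (lowerUnipotent_mul _ _).symm

theorem upperUnipotent_zpow (m n : ℤ) : upperUnipotent m ^ n = upperUnipotent (n * m) := by
  have := map_zpow upperHom (Multiplicative.ofAdd m) n
  simpa [upperHom] using this.symm

theorem lowerUnipotent_zpow (m n : ℤ) : lowerUnipotent m ^ n = lowerUnipotent (n * m) := by
  have := map_zpow lowerHom (Multiplicative.ofAdd m) n
  simpa [lowerHom] using this.symm

/-- Sanov's representation of the free group of rank two. -/
def sanov : FreeGroup Bool →* Matrix.SpecialLinearGroup (Fin 2) ℤ :=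
  FreeGroup.lift fun i => if i then upperUnipotent 2 else lowerUnipotent 2

theorem sanov_true_zpow (n : ℤ) : sanov (of true ^ n) = upperUnipotent (n * 2) := by
  simp [sanov, upperUnipotent_zpow]

theorem sanov_false_zpow (n : ℤ) : sanov (of false ^ n) = lowerUnipotent (n * 2) := by
  simp [sanov, lowerUnipotent_zpow]

theorem upperUnipotent_mul_col (n : ℤ) (M : Matrix.SpecialLinearGroup (Fin 2) ℤ) :
    (upperUnipotent n * M) 0 0 = M 0 0 + n * M 1 0 ∧ (upperUnipotent n * M) 1 0 = M 1 0 := by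
  simp [Matrix.mul_apply, Fin.sum_univ_two]

theorem lowerUnipotent_mul_col (n : ℤ) (M : Matrix.SpecialLinearGroup (Fin 2) ℤ) :
    (lowerUnipotent n * M) 0 0 = M 0 0 ∧ (lowerUnipotent n * M) 1 0 = n * M 0 0 + M 1 0 := by
  simp [Matrix.mul_apply, Fin.sum_univ_two]

theorem abs_lt_abs_add_two_mul {x y n : ℤ} (hn : n ≠ 0) (h : |x| < |y|) :
    |y| < |x + n * 2 * y| := by
  have h1 : |n * 2 * y| ≤ |x + n * 2 * y| + |x| := by
    have := abs_sub (x + n * 2 * y) x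
    simpa using this
  rw [abs_mul, abs_mul] at h1
  have h2 : 1 ≤ |n| := Int.one_le_abs hn
  have h3 : |(2 : ℤ)| = 2 := rfl
  rw [h3] at h1
  nlinarith [abs_nonneg x]

theorem LeadsWith.sanov_col {ε : ℤ} {u : FreeGroup Bool} (h : LeadsWith ε u) :
    |sanov u 0 0| < |sanov u 1 0| ∧ 0 ≤ ε * (sanov u 0 0 * sanov u 1 0) := by
  induction h with
  | base ε n hε =>
    rw [map_mul, sanov_true_zpow, sanov_false_zpow, (lowerUnipotent_mul_col _ _).1,
      (lowerUnipotent_mul_col _ _).2]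
    rcases hε with rfl | rfl <;> simp
  | step ε δ n u hε hu hn ih =>
    rw [map_mul, map_mul, mul_assoc, sanov_true_zpow, sanov_false_zpow,
      (lowerUnipotent_mul_col _ _).1, (lowerUnipotent_mul_col _ _).2,
      (upperUnipotent_mul_col _ _).1, (upperUnipotent_mul_col _ _).2]
    generalize sanov u 0 0 = x at *
    generalize sanov u 1 0 = y at *
    by_cases hn0 : n = 0
    · obtain rfl := hn hn0
      subst hn0
      rcases hε with rfl | rfl
      · simp only [one_mul, zero_mul, add_zero] at *
        rcases abs_cases x with hx | hx <;> rcases abs_cases y with hy | hy <;>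
          rcases abs_cases (2 * x + y) with hz | hz <;> constructor <;> nlinarith
      · simp only [zero_mul, add_zero] at *
        rcases abs_cases x with hx | hx <;> rcases abs_cases y with hy | hy <;>
          rcases abs_cases (-1 * 2 * x + y) with hz | hz <;> constructor <;> nlinarith
    · have hX := abs_lt_abs_add_two_mul hn0 ih.1
      generalize x + n * 2 * y = X at *
      rcases hε with rfl | rfl
      · rcases abs_cases X with hx | hx <;> rcases abs_cases y with hy | hy <;>
          rcases abs_cases (1 * 2 * X + y) with hz | hz <;> constructor <;> nlinarith
      · rcases abs_cases X with hx | hx <;> rcases abs_cases y with hy | hy <;>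
          rcases abs_cases (-1 * 2 * X + y) with hz | hz <;> constructor <;> nlinarith

theorem LeadsWith.ne_zpow_mul {ε δ n : ℤ} {u v : FreeGroup Bool} (hu : LeadsWith ε u)
    (hv : LeadsWith δ v) (hn : n ≠ 0) : u ≠ of true ^ n * v := by
  rintro rfl
  have h1 := hu.sanov_col.1
  rw [map_mul, sanov_true_zpow, (upperUnipotent_mul_col _ _).1,
    (upperUnipotent_mul_col _ _).2] at h1
  exact absurd (abs_lt_abs_add_two_mul hn hv.sanov_col.1) (not_lt.mpr h1.le)

theorem LeadsWith.map_twist {ψ : FreeGroup Bool →* FreeGroup Bool} {k : ℤ}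
    (ht : ψ (of true) = of true) (hf : ψ (of false) = of true ^ k * of false * of true ^ k)
    {ε : ℤ} {u : FreeGroup Bool} (h : LeadsWith ε u) :
    ∃ v, LeadsWith ε v ∧ ψ u = of true ^ (ε * k) * v := by
  have hz : ∀ ε : ℤ, ε = 1 ∨ ε = -1 →
      ψ (of false ^ ε) = of true ^ (ε * k) * of false ^ ε * of true ^ (ε * k) := by
    rintro ε (rfl | rfl)
    · simp [hf]
    · simp [hf, mul_assoc]
  induction h with
  | base ε n hε =>
    refine ⟨_, .base ε (ε * k + n) hε, ?_⟩
    rw [map_mul, hz ε hε, map_zpow, ht, zpow_add]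
    simp only [mul_assoc]
  | step ε δ n u hε hu hn ih =>
    obtain ⟨v, hv, hψ⟩ := ih
    refine ⟨_, .step ε δ (ε * k + n + δ * k) v hε hv ?_, ?_⟩
    · intro h0
      have := hu.sign
      rcases hε with rfl | rfl <;> rcases this with rfl | rfl <;> first | rfl | (apply hn; linarith)
    · rw [map_mul, map_mul, hz ε hε, map_zpow, ht, hψ, zpow_add, zpow_add]
      simp only [mul_assoc]

/-- The fixed points of `a ↦ a`, `b ↦ aᵏ b aᵏ` are the powers of `a` when `k ≠ 0`. -/
theorem exists_zpow_of_fixed {ψ : FreeGroup Bool →* FreeGroup Bool} {k : ℤ} (hk : k ≠ 0)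
    (ht : ψ (of true) = of true) (hf : ψ (of false) = of true ^ k * of false * of true ^ k)
    {w : FreeGroup Bool} (hw : ψ w = w) : ∃ n : ℤ, w = of true ^ n := by
  obtain h | ⟨n, ε, u, hu, rfl⟩ := exists_leadsWith w
  · exact h
  · obtain ⟨v, hv, hψ⟩ := hu.map_twist ht hf
    rw [map_mul, map_zpow, ht, hψ, mul_right_inj] at hw
    refine absurd hw.symm (hu.ne_zpow_mul hv (mul_ne_zero ?_ hk))
    rcases hu.sign with rfl | rfl <;> decide

end FreeGroupRankTwo

section ThreeStrands

/-- The word in `U⁻¹S` (letter `true`) and `U⁻²S` (letter `false`) spelled by a list. -/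
def modularWord {G : Type*} [Group G] (U S : G) (l : List Bool) : G :=
  (l.map fun b => if b then U⁻¹ * S else U⁻¹ * U⁻¹ * S).prod

theorem modularWord_cons {G : Type*} [Group G] (U S : G) (b : Bool) (l : List Bool) :
    modularWord U S (b :: l) =
      (if b then U⁻¹ * S else U⁻¹ * U⁻¹ * S) * modularWord U S l := by
  simp [modularWord]

/-- The normal form `U³ᵏ Sʲ p Uⁱ` with `p` a word in `U⁻¹S` and `U⁻²S`. -/
def HasModularForm {G : Type*} [Group G] (U S x : G) : Prop :=
  ∃ (k : ℤ) (j i : ℕ) (l : List Bool), j < 2 ∧ i < 3 ∧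
    x = (U ^ 3) ^ k * S ^ j * modularWord U S l * U ^ i

section

variable {G : Type*} [Group G] {U S x : G}

theorem HasModularForm.zpow_mul (h : HasModularForm U S x) (m : ℤ) :
    HasModularForm U S ((U ^ 3) ^ m * x) := by
  obtain ⟨k, j, i, l, hj, hi, rfl⟩ := h
  exact ⟨m + k, j, i, l, hj, hi, by rw [zpow_add]; simp only [mul_assoc]⟩

theorem HasModularForm.fst_mul (h : HasModularForm U S x) :
    HasModularForm U S (U * x) := by
  obtain ⟨k, j, i, l, hj, hi, rfl⟩ := h
  have hU : U * (U ^ 3) ^ k = (U ^ 3) ^ k * U :=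
    (((Commute.refl U).pow_right 3).zpow_right k).eq
  simp only [← mul_assoc]
  rw [hU]
  simp only [mul_assoc]
  apply HasModularForm.zpow_mul
  interval_cases j
  · cases l with
    | nil =>
      by_cases h2 : i = 2
      · exact ⟨1, 0, 0, [], by simp, by simp, by subst h2; simp [modularWord, pow_succ, mul_assoc]⟩
      · exact ⟨0, 0, i + 1, [], by simp, by omega, by simp [modularWord, pow_succ']⟩
    | cons b l =>
      cases b
      · exact ⟨0, 0, i, true :: l, by simp, hi, by simp [modularWord_cons, mul_assoc]⟩
      · exact ⟨0, 1, i, l, by simp, hi, by simp [modularWord_cons, mul_assoc]⟩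
  · exact ⟨1, 0, i, false :: l, by simp, hi, by simp [modularWord_cons, mul_assoc, pow_succ]⟩

theorem HasModularForm.snd_mul (hUS : S ^ 2 = U ^ 3) (h : HasModularForm U S x) :
    HasModularForm U S (S * x) := by
  obtain ⟨k, j, i, l, hj, hi, rfl⟩ := h
  have hS : S * (U ^ 3) ^ k = (U ^ 3) ^ k * S := by
    rw [← hUS]
    exact (((Commute.refl S).pow_right 2).zpow_right k).eq
  simp only [← mul_assoc]
  rw [hS]
  simp only [mul_assoc]
  apply HasModularForm.zpow_mul
  interval_cases j
  · exact ⟨0, 1, i, l, by simp, hi, by simp [mul_assoc]⟩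
  · exact ⟨1, 0, i, l, by simp, hi, by simp [← hUS, pow_two, mul_assoc]⟩

theorem hasModularForm_of_closure (hUS : S ^ 2 = U ^ 3)
    (hgen : Subgroup.closure {U, S} = (⊤ : Subgroup G)) (x : G) : HasModularForm U S x := by
  have hx : x ∈ Subgroup.closure {U, S} := hgen ▸ Subgroup.mem_top x
  induction hx using Subgroup.closure_induction_left with
  | one => exact ⟨0, 0, 0, [], by simp, by simp, by simp [modularWord]⟩
  | mul_left g hg y _ ih =>
    rcases hg with rfl | rfl
    · exact ih.fst_mul
    · exact ih.snd_mul hUS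
  | inv_mul_cancel g hg y _ ih =>
    rcases hg with rfl | rfl
    · have := ((ih.fst_mul).fst_mul).zpow_mul (-1)
      convert this using 1
      simp [pow_succ, mul_assoc]
    · have := (ih.snd_mul hUS).zpow_mul (-1)
      convert this using 1
      simp [← hUS, pow_succ, mul_assoc]

end

theorem modularWord_entries {G : Type*} [Group G] {U S : G}
    (r : G →* Matrix.SpecialLinearGroup (Fin 2) ℤ) (hs : r (U⁻¹ * S) = upperUnipotent 1)
    (ht : r (U⁻¹ * U⁻¹ * S) = lowerUnipotent 1) (l : List Bool) :
    1 ≤ r (modularWord U S l) 0 0 ∧ 0 ≤ r (modularWord U S l) 0 1 ∧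
      0 ≤ r (modularWord U S l) 1 0 ∧ 1 ≤ r (modularWord U S l) 1 1 ∧
      (l = [] ∨ 1 ≤ r (modularWord U S l) 0 1 + r (modularWord U S l) 1 0) := by
  induction l with
  | nil => simp [modularWord]
  | cons b l ih =>
    obtain ⟨h1, h2, h3, h4, -⟩ := ih
    rw [modularWord_cons, map_mul]
    generalize r (modularWord U S l) = M at *
    cases b
    · simp only [Bool.false_eq_true, if_false, ht]
      simp [Matrix.mul_apply, Fin.sum_univ_two]
      omega
    · simp only [if_true, hs]
      simp [Matrix.mul_apply, Fin.sum_univ_two]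
      omega

theorem eq_zpow_of_map_eq_one_or {G : Type*} [Group G] {U S : G} (hUS : S ^ 2 = U ^ 3)
    (hgen : Subgroup.closure {U, S} = (⊤ : Subgroup G))
    (r : G →* Matrix.SpecialLinearGroup (Fin 2) ℤ)
    (hU : (r U : Matrix (Fin 2) (Fin 2) ℤ) = !![0, 1; -1, 1])
    (hS : (r S : Matrix (Fin 2) (Fin 2) ℤ) = !![0, 1; -1, 0])
    {x : G} (hx : r x = 1 ∨ r x = -1) : ∃ k : ℤ, x = (U ^ 3) ^ k := by
  obtain ⟨k, j, i, l, hj, hi, rfl⟩ := hasModularForm_of_closure hUS hgen x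
  have hz : r (U ^ 3) = -1 := by
    ext a b
    rw [map_pow, Matrix.SpecialLinearGroup.coe_pow, hU]
    fin_cases a <;> fin_cases b <;> simp [pow_succ, Matrix.mul_apply, Fin.sum_univ_two]
  have hzk : r ((U ^ 3) ^ k) = 1 ∨ r ((U ^ 3) ^ k) = -1 := by
    rw [map_zpow, hz]
    rcases Int.even_or_odd k with h | h
    · exact Or.inl h.neg_one_zpow
    · exact Or.inr h.neg_one_zpow
  have hx' : r (S ^ j * modularWord U S l * U ^ i) = 1 ∨
      r (S ^ j * modularWord U S l * U ^ i) = -1 := by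
    rw [mul_assoc, mul_assoc, map_mul, ← mul_assoc] at hx
    rcases hzk with h | h <;> rw [h] at hx
    · simpa using hx
    · rw [neg_one_mul, neg_inj, neg_eq_iff_eq_neg] at hx
      exact hx.symm
  have hs : r (U⁻¹ * S) = upperUnipotent 1 := by
    rw [map_mul, map_inv, inv_mul_eq_iff_eq_mul]
    ext a b
    rw [Matrix.SpecialLinearGroup.coe_mul, hU, hS]
    fin_cases a <;> fin_cases b <;> simp [Matrix.mul_apply, Fin.sum_univ_two]
  have ht : r (U⁻¹ * U⁻¹ * S) = lowerUnipotent 1 := by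
    rw [mul_assoc, map_mul, hs, map_inv, inv_mul_eq_iff_eq_mul]
    ext a b
    rw [Matrix.SpecialLinearGroup.coe_mul, hU]
    fin_cases a <;> fin_cases b <;> simp [Matrix.mul_apply, Fin.sum_univ_two]
  obtain ⟨h1, h2, h3, h4, h5⟩ := modularWord_entries r hs ht l
  have key : i = 0 ∧ j = 0 ∧ l = [] := by
    rw [map_mul, map_mul, map_pow, map_pow] at hx'
    generalize r (modularWord U S l) = M at *
    rcases hx' with h | h
    all_goals
      have e := fun a b => congrArg
        (fun A : Matrix.SpecialLinearGroup (Fin 2) ℤ => (A : Matrix (Fin 2) (Fin 2) ℤ) a b) h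
      have e00 := e 0 0
      have e01 := e 0 1
      have e10 := e 1 0
      have e11 := e 1 1
      interval_cases j <;> interval_cases i <;>
        simp [hU, hS, pow_two, Matrix.mul_apply, Matrix.vecMul, dotProduct, Fin.sum_univ_two]
          at e00 e01 e10 e11 ⊢ <;>
        first
        | omega
        | (rcases h5 with h5 | h5
           · exact h5
           · omega)
  obtain ⟨rfl, rfl, rfl⟩ := key
  exact ⟨k, by simp [modularWord]⟩

/-- In a group generated by `s`, `t` with `sts = tst` that maps to `SL(2, ℤ)` in the standard way,
an element whose image commutes with a nontrivial power of the image of `s` lies in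
`⟨(st)³, s⟩`. -/
theorem exists_zpow_mul_zpow_of_commute {G : Type*} [Group G] {s t : G} (hst : s * t * s = t * s * t)
    (hgen : Subgroup.closure {s, t} = (⊤ : Subgroup G))
    (r : G →* Matrix.SpecialLinearGroup (Fin 2) ℤ) (hs : r s = upperUnipotent 1)
    (ht : r t = lowerUnipotent (-1)) {m : ℤ} (hm : m ≠ 0) {x : G}
    (hx : r x * upperUnipotent m = upperUnipotent m * r x) :
    ∃ k n : ℤ, x = ((s * t) ^ 3) ^ k * s ^ n := by
  have hUS : (s * t * s) ^ 2 = (s * t) ^ 3 := by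
    calc (s * t * s) ^ 2 = s * t * s * (s * t * s) := pow_two _
      _ = s * t * s * (t * s * t) := by rw [← hst]
      _ = (s * t) ^ 3 := by simp only [pow_succ, pow_zero, one_mul, mul_assoc]
  have hgen' : Subgroup.closure {s * t, s * t * s} = (⊤ : Subgroup G) := by
    rw [eq_top_iff, ← hgen, Subgroup.closure_le]
    have hU : s * t ∈ Subgroup.closure {s * t, s * t * s} := Subgroup.subset_closure (by simp)
    have hS : s * t * s ∈ Subgroup.closure {s * t, s * t * s} := Subgroup.subset_closure (by simp)
    have hs' : s ∈ Subgroup.closure {s * t, s * t * s} := by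
      simpa [mul_assoc] using mul_mem (inv_mem hU) hS
    rintro g (rfl | rfl)
    · exact hs'
    · simpa using mul_mem (inv_mem hs') hU
  have hU : (r (s * t) : Matrix (Fin 2) (Fin 2) ℤ) = !![0, 1; -1, 1] := by
    rw [map_mul, hs, ht]; simp
  have hS : (r (s * t * s) : Matrix (Fin 2) (Fin 2) ℤ) = !![0, 1; -1, 0] := by
    rw [map_mul, map_mul, hs, ht]; simp
  obtain ⟨n, hn⟩ : ∃ n : ℤ, r x = upperUnipotent n ∨ r x = -upperUnipotent n := by
    have hdet := (r x).det_coe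
    rw [Matrix.det_fin_two] at hdet
    generalize r x = M at *
    have e := fun a b => congrArg
      (fun A : Matrix.SpecialLinearGroup (Fin 2) ℤ => (A : Matrix (Fin 2) (Fin 2) ℤ) a b) hx
    have e00 := e 0 0
    have e01 := e 0 1
    simp [Matrix.mul_apply, Fin.sum_univ_two] at e00 e01
    have h10 : M 1 0 = 0 := by
      rcases e00 with h | h
      · exact absurd h hm
      · exact h
    have h11 : M 0 0 = M 1 1 := by
      apply mul_right_cancel₀ hm
      linarith
    rw [h10, ← h11, mul_zero, sub_zero] at hdet
    rcases Int.mul_eq_one_iff_eq_one_or_neg_one.mp hdet with ⟨h, -⟩ | ⟨h, -⟩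
    · refine ⟨M 0 1, Or.inl ?_⟩
      ext a b
      fin_cases a <;> fin_cases b <;> simp [h, h10, ← h11]
    · refine ⟨-M 0 1, Or.inr ?_⟩
      ext a b
      fin_cases a <;> fin_cases b <;> simp [h, h10, ← h11]
  have hx1 : r (x * s ^ (-n)) = 1 ∨ r (x * s ^ (-n)) = -1 := by
    rw [map_mul, map_zpow, hs, upperUnipotent_zpow]
    rcases hn with h | h <;> rw [h]
    · left; rw [upperUnipotent_mul]; simp [upperUnipotent_zero]
    · right; rw [neg_mul, upperUnipotent_mul]; simp [upperUnipotent_zero]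
  obtain ⟨k, hk⟩ := eq_zpow_of_map_eq_one_or hUS hgen' r hU hS hx1
  exact ⟨k, n, by rw [← hk]; simp⟩

end ThreeStrands

section FourStrands

open FreeGroup (of)

/-- The first standard generator of `B_4`. -/
abbrev b₁ : BraidGroup 4 := σ ⟨0, by omega⟩

/-- The second standard generator of `B_4`. -/
abbrev b₂ : BraidGroup 4 := σ ⟨1, by omega⟩

/-- The third standard generator of `B_4`. -/
abbrev b₃ : BraidGroup 4 := σ ⟨2, by omega⟩

theorem braid_one_two : b₁ * b₂ * b₁ = b₂ * b₁ * b₂ :=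
  PresentedGroup.mk_eq_mk_of_mul_inv_mem (Or.inr ⟨⟨0, by omega⟩, ⟨1, by omega⟩, rfl, rfl⟩)

theorem braid_two_three : b₂ * b₃ * b₂ = b₃ * b₂ * b₃ :=
  PresentedGroup.mk_eq_mk_of_mul_inv_mem (Or.inr ⟨⟨1, by omega⟩, ⟨2, by omega⟩, rfl, rfl⟩)

theorem braid_one_three : b₁ * b₃ = b₃ * b₁ :=
  PresentedGroup.mk_eq_mk_of_mul_inv_mem
    (Or.inl ⟨⟨0, by omega⟩, ⟨2, by omega⟩, le_rfl, by rw [mul_inv_rev, ← mul_assoc]⟩)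

theorem c4_eq : c4 = b₃ * b₁⁻¹ := rfl

theorem Δ4_eq : Δ4 = b₁ * b₂ * b₃ * b₁ * b₂ * b₁ := rfl

theorem d4_eq : d4 = b₁ ^ 3 * b₃ ^ 3 * Δ4⁻¹ := rfl

theorem closure_generators : Subgroup.closure {b₁, b₂, b₃} = (⊤ : Subgroup (BraidGroup 4)) := by
  rw [eq_top_iff, ← PresentedGroup.closure_range_of, Subgroup.closure_le]
  rintro _ ⟨i, rfl⟩
  apply Subgroup.subset_closure
  fin_cases i
  · exact Or.inl rfl
  · exact Or.inr (Or.inl rfl)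
  · exact Or.inr (Or.inr rfl)

section Lift

variable {G : Type*} [Group G] {g₁ g₂ g₃ : G}

/-- The homomorphism out of `B_4` determined by elements satisfying the braid relations. -/
def braidLift (h12 : g₁ * g₂ * g₁ = g₂ * g₁ * g₂) (h23 : g₂ * g₃ * g₂ = g₃ * g₂ * g₃)
    (h13 : g₁ * g₃ = g₃ * g₁) : BraidGroup 4 →* G :=
  PresentedGroup.toGroup (f := (![g₁, g₂, g₃] : Fin 3 → G)) (by
    rintro r (⟨i, j, hij, rfl⟩ | ⟨i, j, hij, rfl⟩)
    · obtain ⟨i, hi⟩ := i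
      obtain ⟨j, hj⟩ := j
      simp only at hij
      obtain rfl : i = 0 := by omega
      obtain rfl : j = 2 := by omega
      simp only [map_mul, map_inv, FreeGroup.lift_apply_of]
      rw [mul_assoc, ← mul_inv_rev, mul_inv_eq_one]
      exact h13
    · obtain ⟨i, hi⟩ := i
      obtain ⟨j, hj⟩ := j
      simp only at hij
      subst hij
      simp only [map_mul, map_inv, FreeGroup.lift_apply_of]
      rw [mul_inv_eq_one]
      have : i = 0 ∨ i = 1 := by omega
      rcases this with rfl | rfl
      · exact h12
      · exact h23)

variable (h12 : g₁ * g₂ * g₁ = g₂ * g₁ * g₂) (h23 : g₂ * g₃ * g₂ = g₃ * g₂ * g₃)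
  (h13 : g₁ * g₃ = g₃ * g₁)

@[simp] theorem braidLift_one : braidLift h12 h23 h13 b₁ = g₁ := PresentedGroup.toGroup.of _

@[simp] theorem braidLift_two : braidLift h12 h23 h13 b₂ = g₂ := PresentedGroup.toGroup.of _

@[simp] theorem braidLift_three : braidLift h12 h23 h13 b₃ = g₃ := PresentedGroup.toGroup.of _

end Lift

/-- The exponent sum homomorphism. -/
def exponentSum : BraidGroup 4 →* Multiplicative ℤ :=
  braidLift (g₁ := .ofAdd 1) (g₂ := .ofAdd 1) (g₃ := .ofAdd 1) rfl rfl rfl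

/-- The standard representation `B_4 → B_3 → SL(2, ℤ)`. -/
def modularRep : BraidGroup 4 →* Matrix.SpecialLinearGroup (Fin 2) ℤ :=
  braidLift (g₁ := upperUnipotent 1) (g₂ := lowerUnipotent (-1)) (g₃ := upperUnipotent 1)
    (by ext i j; fin_cases i <;> fin_cases j <;> simp)
    (by ext i j; fin_cases i <;> fin_cases j <;> simp) rfl

theorem semidirect_braid_two_three :
    (⟨1, freeTurn⟩ * ⟨of true, freeShear⟩ * ⟨1, freeTurn⟩ :
      SemidirectProduct (FreeGroup Bool) (MulAut (FreeGroup Bool)) (MonoidHom.id _)) =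
    ⟨of true, freeShear⟩ * ⟨1, freeTurn⟩ * ⟨of true, freeShear⟩ := by
  ext1
  · simp
  · simp only [SemidirectProduct.mul_right]
    exact freeShear_freeTurn_braid.symm

/-- The homomorphism from `B_4` to the holomorph of the free group of rank two. -/
def holomorphRep : BraidGroup 4 →*
    SemidirectProduct (FreeGroup Bool) (MulAut (FreeGroup Bool)) (MonoidHom.id _) :=
  braidLift (g₁ := ⟨1, freeShear⟩) (g₂ := ⟨1, freeTurn⟩) (g₃ := ⟨of true, freeShear⟩)
    (by
      ext1
      · simp
      · exact freeShear_freeTurn_braid)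
    semidirect_braid_two_three
    (by ext1 <;> simp)

/-- The homomorphism from the free group of rank two onto the kernel of `B_4 → B_3`. -/
def freeToBraid : FreeGroup Bool →* BraidGroup 4 :=
  FreeGroup.lift fun i => if i then c4 else b₂ * c4 * b₂⁻¹

@[simp] theorem freeToBraid_true : freeToBraid (of true) = c4 := by simp [freeToBraid]

@[simp] theorem freeToBraid_false : freeToBraid (of false) = b₂ * c4 * b₂⁻¹ := by
  simp [freeToBraid]

theorem holomorphRep_freeToBraid (w : FreeGroup Bool) :
    holomorphRep (freeToBraid w) = SemidirectProduct.inl w := by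
  have h : holomorphRep.comp freeToBraid = SemidirectProduct.inl := by
    apply FreeGroup.ext_hom
    intro i
    have hc : holomorphRep c4 = SemidirectProduct.inl (of true) := by
      rw [c4_eq, map_mul, map_inv]
      ext1 <;> simp [holomorphRep]
    cases i
    · simp only [MonoidHom.comp_apply, freeToBraid_false, map_mul, map_inv, hc]
      ext1 <;> simp [holomorphRep]
    · simp [hc]
  exact DFunLike.congr_fun h w

theorem freeToBraid_injective : Function.Injective freeToBraid := fun v w h =>
  SemidirectProduct.inl_injective (φ := MonoidHom.id (MulAut (FreeGroup Bool))) <| by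
    rw [← holomorphRep_freeToBraid, ← holomorphRep_freeToBraid, h]

section Identities

variable {G : Type*} [Group G] {x y z : G}

theorem braid_conj_inv (h : x * y * x = y * x * y) : x⁻¹ * y⁻¹ * x⁻¹ = y⁻¹ * x⁻¹ * y⁻¹ := by
  have := congrArg (·⁻¹) h
  simpa [mul_assoc] using this

theorem braid_shift (h : y * z * y = z * y * z) : z⁻¹ * y * z = y * z * y⁻¹ := by
  rw [eq_mul_inv_iff_mul_eq, mul_assoc, mul_assoc, inv_mul_eq_iff_eq_mul, ← mul_assoc, h,
    ← mul_assoc]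

theorem braid_one_conj_identity (hxy : x * y * x = y * x * y) (hyz : y * z * y = z * y * z) :
    (z * x⁻¹)⁻¹ * (y * (z * x⁻¹) * y⁻¹) = x * (y * (z * x⁻¹) * y⁻¹) * x⁻¹ := by
  calc (z * x⁻¹)⁻¹ * (y * (z * x⁻¹) * y⁻¹) = x * (z⁻¹ * y * z) * x⁻¹ * y⁻¹ := by group
    _ = x * y * z * (y⁻¹ * x⁻¹ * y⁻¹) := by rw [braid_shift hyz]; group
    _ = x * (y * (z * x⁻¹) * y⁻¹) * x⁻¹ := by rw [← braid_conj_inv hxy]; group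

theorem braid_two_conj_identity (hxy : x * y * x = y * x * y) (hyz : y * z * y = z * y * z)
    (hxz : x * z = z * x) :
    y * (z * x⁻¹) * y⁻¹ * (z * x⁻¹)⁻¹ * (y * (z * x⁻¹) * y⁻¹) =
      y * (y * (z * x⁻¹) * y⁻¹) * y⁻¹ := by
  have hc : x⁻¹ * z = z * x⁻¹ := by
    rw [inv_mul_eq_iff_eq_mul, ← mul_assoc, hxz, mul_inv_cancel_right]
  calc y * (z * x⁻¹) * y⁻¹ * (z * x⁻¹)⁻¹ * (y * (z * x⁻¹) * y⁻¹)
      = y * z * (x⁻¹ * y⁻¹ * x) * (z⁻¹ * y * z) * x⁻¹ * y⁻¹ := by group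
    _ = y * z * (y * x⁻¹ * y⁻¹) * (y * z * y⁻¹) * x⁻¹ * y⁻¹ := by
        rw [braid_shift hyz, show x⁻¹ * y⁻¹ * x = y * x⁻¹ * y⁻¹ by
          simpa [mul_assoc] using congrArg (·⁻¹) (braid_shift hxy.symm)]
    _ = y * z * y * (x⁻¹ * z) * y⁻¹ * x⁻¹ * y⁻¹ := by group
    _ = y * (z * y * z) * x⁻¹ * (y⁻¹ * x⁻¹ * y⁻¹) := by rw [hc]; group
    _ = y * y * z * y * x⁻¹ * (x⁻¹ * y⁻¹ * x⁻¹) := by rw [← hyz, braid_conj_inv hxy]; group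
    _ = y * y * z * y * x⁻¹ * (y⁻¹ * x⁻¹ * y⁻¹) := by rw [braid_conj_inv hxy]
    _ = y * y * z * y * (x⁻¹ * y⁻¹ * x⁻¹) * y⁻¹ := by group
    _ = y * (y * (z * x⁻¹) * y⁻¹) * y⁻¹ := by rw [braid_conj_inv hxy]; group

theorem garside_mul_one (hxy : x * y * x = y * x * y) (hyz : y * z * y = z * y * z)
    (hxz : x * z = z * x) :
    x * y * z * x * y * x * x = z * (x * y * z * x * y * x) := by
  calc x * y * z * x * y * x * x = x * y * z * (x * y * x) * x := by simp only [mul_assoc]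
    _ = x * (y * z * y) * x * y * x := by rw [hxy]; simp only [mul_assoc]
    _ = (x * z) * y * z * x * y * x := by rw [hyz]; simp only [mul_assoc]
    _ = z * (x * y * z * x * y * x) := by rw [hxz]; simp only [mul_assoc]

theorem garside_mul_two (hxy : x * y * x = y * x * y) (hxz : x * z = z * x) :
    x * y * z * x * y * x * y = y * (x * y * z * x * y * x) := by
  calc x * y * z * x * y * x * y = x * y * z * x * (y * x * y) := by simp only [mul_assoc]
    _ = x * y * (z * x) * x * y * x := by rw [← hxy]; simp only [mul_assoc]
    _ = (x * y * x) * z * x * y * x := by rw [← hxz]; simp only [mul_assoc]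
    _ = y * (x * y * z * x * y * x) := by rw [hxy]; simp only [mul_assoc]

theorem garside_mul_three (hxy : x * y * x = y * x * y) (hyz : y * z * y = z * y * z)
    (hxz : x * z = z * x) :
    x * y * z * x * y * x * z = x * (x * y * z * x * y * x) := by
  calc x * y * z * x * y * x * z = x * y * (z * x) * y * (x * z) := by simp only [mul_assoc]
    _ = x * y * (x * z) * y * (z * x) := by rw [hxz]
    _ = x * y * x * (z * y * z) * x := by simp only [mul_assoc]
    _ = x * (y * x * y) * z * y * x := by rw [← hyz]; simp only [mul_assoc]
    _ = x * x * y * (x * z) * y * x := by rw [← hxy]; simp only [mul_assoc]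
    _ = x * (x * y * z * x * y * x) := by rw [hxz]; simp only [mul_assoc]

end Identities
theorem Δ4_mul_one : Δ4 * b₁ = b₃ * Δ4 :=
  garside_mul_one braid_one_two braid_two_three braid_one_three

theorem Δ4_mul_two : Δ4 * b₂ = b₂ * Δ4 := garside_mul_two braid_one_two braid_one_three

theorem Δ4_mul_three : Δ4 * b₃ = b₁ * Δ4 :=
  garside_mul_three braid_one_two braid_two_three braid_one_three

theorem commute_Δ4_sq (x : BraidGroup 4) : Commute x (Δ4 ^ 2) := by
  have h : (⊤ : Subgroup (BraidGroup 4)) ≤ Subgroup.centralizer {Δ4 ^ 2} := by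
    rw [← closure_generators, Subgroup.closure_le]
    rintro g (rfl | rfl | rfl) <;> rw [SetLike.mem_coe, Subgroup.mem_centralizer_singleton_iff]
    · rw [pow_two, mul_assoc, Δ4_mul_one, ← mul_assoc Δ4, Δ4_mul_three, mul_assoc]
    · rw [pow_two, mul_assoc, Δ4_mul_two, ← mul_assoc Δ4, Δ4_mul_two, mul_assoc]
    · rw [pow_two, mul_assoc, Δ4_mul_three, ← mul_assoc Δ4, Δ4_mul_one, mul_assoc]
  exact Subgroup.mem_centralizer_singleton_iff.mp (h (Subgroup.mem_top x))

theorem freeToBraid_shear (w : FreeGroup Bool) :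
    freeToBraid (freeShear w) = b₁ * freeToBraid w * b₁⁻¹ := by
  have h : freeToBraid.comp freeShear.toMonoidHom =
      (MulAut.conj b₁).toMonoidHom.comp freeToBraid := by
    apply FreeGroup.ext_hom
    intro i
    cases i
    · simpa [c4_eq] using braid_one_conj_identity braid_one_two braid_two_three
    · have h13 := braid_one_three
      simp [c4_eq, ← mul_assoc, h13]
  exact DFunLike.congr_fun h w

theorem freeToBraid_turn (w : FreeGroup Bool) :
    freeToBraid (freeTurn w) = b₂ * freeToBraid w * b₂⁻¹ := by
  have h : freeToBraid.comp freeTurn.toMonoidHom =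
      (MulAut.conj b₂).toMonoidHom.comp freeToBraid := by
    apply FreeGroup.ext_hom
    intro i
    cases i
    · simpa [c4_eq] using
        braid_two_conj_identity braid_one_two braid_two_three braid_one_three
    · simp
  exact DFunLike.congr_fun h w

theorem exists_freeAut_conj (g : BraidGroup 4) :
    ∃ τ : MulAut (FreeGroup Bool), ∀ w, freeToBraid (τ w) = g * freeToBraid w * g⁻¹ := by
  have hg : g ∈ Subgroup.closure {b₁, b₂, b₃} := closure_generators ▸ Subgroup.mem_top g
  induction hg using Subgroup.closure_induction with
  | mem g hg =>
    rcases hg with rfl | rfl | rfl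
    · exact ⟨freeShear, freeToBraid_shear⟩
    · exact ⟨freeTurn, freeToBraid_turn⟩
    · refine ⟨MulAut.conj (of true) * freeShear, fun w => ?_⟩
      have h : b₃ = c4 * b₁ := by rw [c4_eq, inv_mul_cancel_right]
      rw [h, MulAut.mul_apply, MulAut.conj_apply, map_mul, map_mul, map_inv, freeToBraid_true,
        freeToBraid_shear]
      simp only [mul_assoc, mul_inv_rev]
  | one => exact ⟨1, by simp⟩
  | mul x y _ _ hx hy =>
    obtain ⟨τ, hτ⟩ := hx
    obtain ⟨τ', hτ'⟩ := hy
    refine ⟨τ * τ', fun w => ?_⟩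
    rw [MulAut.mul_apply, hτ, hτ']
    simp only [mul_assoc, mul_inv_rev]
  | inv x _ hx =>
    obtain ⟨τ, hτ⟩ := hx
    refine ⟨τ⁻¹, fun w => ?_⟩
    have := hτ (τ⁻¹ w)
    rw [MulAut.apply_inv_self] at this
    rw [this]
    group

instance freeToBraid_range_normal : freeToBraid.range.Normal where
  conj_mem := by
    rintro _ ⟨w, rfl⟩ g
    obtain ⟨τ, hτ⟩ := exists_freeAut_conj g
    exact ⟨τ w, hτ w⟩

theorem freeToBraid_range_le_ker {G : Type*} [Group G] {φ : BraidGroup 4 →* G}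
    (h : φ b₁ = φ b₃) : freeToBraid.range ≤ φ.ker := by
  have hc : φ c4 = 1 := by rw [c4_eq, map_mul, map_inv, h, mul_inv_cancel]
  have : φ.comp freeToBraid = 1 := by
    apply FreeGroup.ext_hom
    intro i
    cases i <;> simp [hc]
  rintro _ ⟨w, rfl⟩
  exact DFunLike.congr_fun this w

theorem map_Δ4 {G : Type*} [Group G] (φ : BraidGroup 4 →* G) (h : φ b₃ = φ b₁) :
    φ Δ4 = (φ b₁ * φ b₂) ^ 3 := by
  have h12 : φ b₁ * φ b₂ * φ b₁ = φ b₂ * φ b₁ * φ b₂ := by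
    rw [← map_mul, ← map_mul, braid_one_two, map_mul, map_mul]
  calc φ Δ4 = φ b₁ * φ b₂ * φ b₁ * (φ b₁ * φ b₂ * φ b₁) := by
        simp only [Δ4_eq, map_mul, h, mul_assoc]
    _ = (φ b₁ * φ b₂) ^ 3 := by
        nth_rw 2 [h12]
        simp only [pow_succ, pow_zero, one_mul, mul_assoc]

theorem modularRep_Δ4 : modularRep Δ4 = -1 := by
  rw [map_Δ4 modularRep (by simp [modularRep])]
  ext i j
  fin_cases i <;> fin_cases j <;> simp [modularRep, pow_succ]

theorem modularRep_d4 : modularRep d4 = -upperUnipotent 6 := by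
  rw [d4_eq, map_mul, map_mul, map_inv, modularRep_Δ4, map_pow, map_pow]
  have h : upperUnipotent 1 ^ 3 = upperUnipotent 3 := by
    simpa using upperUnipotent_zpow 1 3
  simp [modularRep, h, upperUnipotent_mul]

theorem modularRep_d4_sq : modularRep (d4 ^ 2) = upperUnipotent 12 := by
  rw [map_pow, modularRep_d4, neg_sq, pow_two, upperUnipotent_mul]
  norm_num

theorem eq_of_braid {G : Type*} [CommGroup G] {x y : G} (h : x * y * x = y * x * y) : x = y := by
  rw [mul_comm y x] at h
  exact mul_left_cancel h

theorem abelianization_of_two : Abelianization.of b₂ = Abelianization.of b₁ :=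
  eq_of_braid (by simpa using (congrArg Abelianization.of braid_one_two).symm)

theorem abelianization_of_three : Abelianization.of b₃ = Abelianization.of b₁ :=
  (eq_of_braid (by simpa using (congrArg Abelianization.of braid_two_three).symm)).trans
    abelianization_of_two

theorem c4_mem_commutator : c4 ∈ commutator (BraidGroup 4) := by
  rw [← Abelianization.ker_of, MonoidHom.mem_ker, c4_eq, map_mul, map_inv,
    abelianization_of_three, mul_inv_cancel]

theorem d4_mem_commutator : d4 ∈ commutator (BraidGroup 4) := by
  rw [← Abelianization.ker_of, MonoidHom.mem_ker, d4_eq, Δ4_eq]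
  simp only [map_mul, map_inv, map_pow, abelianization_of_two, abelianization_of_three]
  group

theorem exponentSum_eq_one {x : BraidGroup 4} (hx : x ∈ commutator (BraidGroup 4)) :
    exponentSum x = 1 :=
  Abelianization.commutator_subset_ker exponentSum hx

theorem commute_c4_one : Commute c4 b₁ := by
  have h : Commute b₃ b₁ := braid_one_three.symm
  exact h.mul_left (Commute.refl b₁).inv_left

theorem d4_sq : d4 ^ 2 = c4 ^ 6 * b₁ ^ 12 * (Δ4 ^ 2)⁻¹ := by
  have h1 : Δ4⁻¹ * (b₁ ^ 3 * b₃ ^ 3) = b₁ ^ 3 * b₃ ^ 3 * Δ4⁻¹ := by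
    have h31 : Commute b₃ b₁ := braid_one_three.symm
    have e1 : Δ4 * b₁ ^ 3 = b₃ ^ 3 * Δ4 := (SemiconjBy.pow_right (a := Δ4) Δ4_mul_one 3).eq
    have e3 : Δ4 * b₃ ^ 3 = b₁ ^ 3 * Δ4 := (SemiconjBy.pow_right (a := Δ4) Δ4_mul_three 3).eq
    rw [inv_mul_eq_iff_eq_mul, ← mul_assoc, ← mul_assoc, e1, mul_assoc (b₃ ^ 3), e3,
      (h31.symm.pow_pow 3 3).eq]
    group
  have h3 : b₃ = c4 * b₁ := by rw [c4_eq, inv_mul_cancel_right]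
  have h2 : b₁ ^ 3 * b₃ ^ 3 = c4 ^ 3 * b₁ ^ 6 := by
    rw [h3, commute_c4_one.mul_pow, ← mul_assoc, (commute_c4_one.symm.pow_pow 3 3).eq,
      mul_assoc, ← pow_add]
  calc d4 ^ 2 = b₁ ^ 3 * b₃ ^ 3 * (Δ4⁻¹ * (b₁ ^ 3 * b₃ ^ 3)) * Δ4⁻¹ := by
        rw [d4_eq, pow_two]; simp only [mul_assoc]
    _ = c4 ^ 3 * (b₁ ^ 6 * c4 ^ 3) * b₁ ^ 6 * (Δ4 ^ 2)⁻¹ := by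
        rw [h1, h2, pow_two Δ4, mul_inv_rev]; simp only [mul_assoc]
    _ = c4 ^ 6 * b₁ ^ 12 * (Δ4 ^ 2)⁻¹ := by
        rw [(commute_c4_one.symm.pow_pow 6 3).eq]; group

theorem exists_zpow_of_commute_d4_sq {w : FreeGroup Bool}
    (h : Commute (freeToBraid w) (d4 ^ 2)) : ∃ n : ℤ, w = of true ^ n := by
  have h1 : Commute (freeToBraid w) (c4 ^ 6 * b₁ ^ 12) := by
    have := h.mul_right (commute_Δ4_sq (freeToBraid w))
    rwa [d4_sq, inv_mul_cancel_right] at this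
  have hc : c4 ^ 6 = freeToBraid (of true ^ 6) := by rw [map_pow, freeToBraid_true]
  have h2 := (h1.map holomorphRep).eq
  have hb : holomorphRep (b₁ ^ 12) = SemidirectProduct.inr (freeShear ^ 12) := by
    rw [map_pow, map_pow]
    exact congrArg (· ^ 12) (braidLift_one _ _ _)
  rw [map_mul, hc, holomorphRep_freeToBraid, holomorphRep_freeToBraid, hb] at h2
  have h3 := congrArg SemidirectProduct.left h2
  simp only [SemidirectProduct.mul_left, SemidirectProduct.mul_right, SemidirectProduct.left_inl,
    SemidirectProduct.right_inl, SemidirectProduct.left_inr, SemidirectProduct.right_inr, map_one,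
    mul_one, one_mul, MulAut.one_apply, MonoidHom.id_apply] at h3
  refine exists_zpow_of_fixed (k := -6)
    (ψ := (MulAut.conj (of true ^ 6) * freeShear ^ 12).toMonoidHom) (by decide) ?_ ?_ ?_
  · simp only [MulEquiv.toMonoidHom_eq_coe, MonoidHom.coe_coe, MulAut.mul_apply,
      freeShear_pow_true, MulAut.conj_apply]
    group
  · have := freeShear_pow_false 12
    simp only [MulEquiv.toMonoidHom_eq_coe, MonoidHom.coe_coe, MulAut.mul_apply, this,
      MulAut.conj_apply]
    group
  · simp only [MulEquiv.toMonoidHom_eq_coe, MonoidHom.coe_coe, MulAut.mul_apply,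
      MulAut.conj_apply]
    rw [← h3, mul_inv_cancel_right]

theorem exists_mul_zpow_mem_range {x : BraidGroup 4} (hx : x ∈ commutator (BraidGroup 4))
    (hd : Commute x (d4 ^ 2)) : ∃ k : ℤ, x * d4 ^ k ∈ freeToBraid.range := by
  let N := freeToBraid.range
  let π : BraidGroup 4 →* BraidGroup 4 ⧸ N := QuotientGroup.mk' N
  have hπ3 : π b₃ = π b₁ := by
    have h : π c4 = 1 :=
      (QuotientGroup.eq_one_iff c4).mpr ⟨of true, freeToBraid_true⟩
    rw [c4_eq, map_mul, map_inv, mul_inv_eq_one] at h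
    exact h
  let r : BraidGroup 4 ⧸ N →* Matrix.SpecialLinearGroup (Fin 2) ℤ :=
    QuotientGroup.lift N modularRep (freeToBraid_range_le_ker (by simp [modularRep]))
  let e : BraidGroup 4 ⧸ N →* Multiplicative ℤ :=
    QuotientGroup.lift N exponentSum (freeToBraid_range_le_ker (by simp [exponentSum]))
  have hr : ∀ y, r (π y) = modularRep y := fun y => rfl
  have he : ∀ y, e (π y) = exponentSum y := fun y => rfl
  have h12 : π b₁ * π b₂ * π b₁ = π b₂ * π b₁ * π b₂ := by
    rw [← map_mul, ← map_mul, braid_one_two, map_mul, map_mul]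
  have hgen : Subgroup.closure {π b₁, π b₂} = ⊤ := by
    have := congrArg (Subgroup.map π) closure_generators
    rw [MonoidHom.map_closure, Subgroup.map_top_of_surjective π (QuotientGroup.mk'_surjective N),
      Set.image_insert_eq, Set.image_pair, hπ3, Set.pair_comm, Set.insert_comm] at this
    simpa [Set.pair_comm] using this
  obtain ⟨k, n, hkn⟩ := exists_zpow_mul_zpow_of_commute h12 hgen r
    (by rw [hr]; simp [modularRep]) (by rw [hr]; simp [modularRep]) (m := 12) (by decide)
    (x := π x) (by rw [hr, ← modularRep_d4_sq]; exact (hd.map modularRep).eq)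
  have hn : n = -(6 * k) := by
    have h := exponentSum_eq_one hx
    rw [← he, hkn, map_mul, map_zpow, map_pow, map_mul, map_zpow, he, he] at h
    have h' := congrArg Multiplicative.toAdd h
    simp [exponentSum] at h'
    omega
  have hcomm : Commute (π b₁) (π Δ4) := by
    have := congrArg π Δ4_mul_one
    rw [map_mul, map_mul, hπ3] at this
    exact this.symm
  have hπd : π d4 = π b₁ ^ 6 * (π Δ4)⁻¹ := by
    rw [d4_eq, map_mul, map_mul, map_inv, map_pow, map_pow, hπ3, ← pow_add]
  refine ⟨k, (QuotientGroup.eq_one_iff _).mp ?_⟩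
  change π (x * d4 ^ k) = 1
  rw [map_mul, map_zpow, hkn, hπd, ← map_Δ4 π hπ3, (hcomm.pow_left 6).inv_right.mul_zpow, hn,
    zpow_neg, zpow_mul]
  simp

theorem c4_zpow_injective : Function.Injective fun m : ℤ => c4 ^ m := by
  intro m n h
  have h1 : freeToBraid (of true ^ m) = freeToBraid (of true ^ n) := by
    simpa using h
  have h2 := congrArg sanov (freeToBraid_injective h1)
  rw [sanov_true_zpow, sanov_true_zpow] at h2
  have h3 := congrArg (fun A : Matrix.SpecialLinearGroup (Fin 2) ℤ => A 0 1) h2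
  simpa using h3

theorem c4_zpow_mul_d4_zpow_injective :
    Function.Injective fun p : ℤ × ℤ => c4 ^ p.1 * d4 ^ p.2 := by
  rintro ⟨m, k⟩ ⟨m', k'⟩ h
  simp only at h
  have hc : modularRep c4 = 1 := by simp [c4_eq, modularRep]
  have hr : ∀ m k : ℤ, modularRep (c4 ^ m * d4 ^ k) ^ 2 = upperUnipotent (k * 12) := by
    intro m k
    rw [map_mul, map_zpow, hc, one_zpow, one_mul, ← upperUnipotent_zpow, ← modularRep_d4_sq,
      ← map_zpow, ← map_pow, ← zpow_natCast, ← zpow_natCast, zpow_comm]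
  have h2 : upperUnipotent (k * 12) = upperUnipotent (k' * 12) := by
    rw [← hr m k, ← hr m' k', h]
  have h3 := congrArg (fun A : Matrix.SpecialLinearGroup (Fin 2) ℤ => A 0 1) h2
  obtain rfl : k = k' := by simpa using h3
  rw [mul_left_inj] at h
  rw [c4_zpow_injective h]

theorem d4_conj_c4 : d4 * c4 * d4⁻¹ = c4⁻¹ := by
  have hΔ : SemiconjBy Δ4 c4⁻¹ c4 := by
    rw [c4_eq, mul_inv_rev, inv_inv]
    have h1 : SemiconjBy Δ4 b₁ b₃ := Δ4_mul_one
    have h3 : SemiconjBy Δ4 b₃ b₁ := Δ4_mul_three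
    exact h1.mul_right h3.inv_right
  have h1 : Commute b₁ c4⁻¹ := commute_c4_one.symm.inv_right
  have h3 : Commute b₃ c4⁻¹ := by
    rw [show b₃ = c4 * b₁ by rw [c4_eq, inv_mul_cancel_right]]
    exact (Commute.refl c4).inv_right.mul_left h1
  have h : SemiconjBy d4 c4 c4⁻¹ :=
    ((h1.pow_left 3).mul_left (h3.pow_left 3)).semiconjBy.mul_left hΔ.inv_symm_left
  rw [h.eq, mul_inv_cancel_right]

theorem commute_c4_d4_sq : Commute c4 (d4 ^ 2) := by
  have h : SemiconjBy d4 c4 c4⁻¹ := by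
    rw [SemiconjBy, ← d4_conj_c4, inv_mul_cancel_right]
  have h' := h.inv_right
  rw [inv_inv] at h'
  have := h'.mul_left h
  rw [← pow_two] at this
  exact Commute.symm this

end FourStrands

/-- `c` and `d` lie in `B'_4`; the centralizer `Z(d²; B'_4)` of `d²` in `B'_4` is the
semidirect product `⟨c⟩ ⋊ ⟨d⟩` of infinite cyclic groups with `dcd⁻¹ = c⁻¹`:
`c` and `d` have infinite order, `dcd⁻¹ = c⁻¹`, and `(m,k) ↦ cᵐdᵏ` is a bijection
from `ℤ × ℤ` onto `Z(d²; B'_4)`. -/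
theorem centralizer_d_squared :
    c4 ∈ commutator (BraidGroup 4) ∧ d4 ∈ commutator (BraidGroup 4) ∧
    (∀ m : ℤ, m ≠ 0 → c4 ^ m ≠ 1) ∧ (∀ k : ℤ, k ≠ 0 → d4 ^ k ≠ 1) ∧
    d4 * c4 * d4⁻¹ = c4⁻¹ ∧
    Function.Injective (fun p : ℤ × ℤ => c4 ^ p.1 * d4 ^ p.2) ∧
    Set.range (fun p : ℤ × ℤ => c4 ^ p.1 * d4 ^ p.2) =
      {x : BraidGroup 4 | x ∈ commutator (BraidGroup 4) ∧ x * d4 ^ 2 = d4 ^ 2 * x} := by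
  refine ⟨c4_mem_commutator, d4_mem_commutator, ?_, ?_, d4_conj_c4,
    c4_zpow_mul_d4_zpow_injective, ?_⟩
  · intro m hm h
    exact hm (c4_zpow_injective (h.trans (zpow_zero c4).symm))
  · intro k hk h
    have := c4_zpow_mul_d4_zpow_injective (a₁ := (0, k)) (a₂ := (0, 0)) (by simp [h])
    simp at this
    exact hk this
  · ext x
    constructor
    · rintro ⟨⟨m, k⟩, rfl⟩
      exact ⟨mul_mem (zpow_mem c4_mem_commutator m) (zpow_mem d4_mem_commutator k),
        ((commute_c4_d4_sq.zpow_left m).mul_left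
          (((Commute.refl d4).pow_right 2).zpow_left k)).eq⟩
    · rintro ⟨hx, hd⟩
      have hd : Commute x (d4 ^ 2) := hd
      obtain ⟨k, w, hw⟩ := exists_mul_zpow_mem_range hx hd
      obtain ⟨m, rfl⟩ := exists_zpow_of_commute_d4_sq (w := w) (by
        rw [hw]
        exact hd.mul_left (((Commute.refl d4).pow_right 2).zpow_left k))
      rw [map_zpow, freeToBraid_true] at hw
      exact ⟨(m, -k), by simp [hw]⟩
end

section
/- Let K_4 be the kernel of the group homomorphism B_4 → B_3 determined by σ_1 ↦ σ_1, σ_2 ↦ σ_2, σ_3 ↦ σ_1; then K_4 is contained in B'_4, and K_4 is a characteristic subgroup of B'_4: for every automorphism φ of B'_4 and every x ∈ B'_4 with x ∈ K_4, one has φ(x) ∈ K_4. -/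
/-! ### Generators and relations of braid groups -/

theorem braid_comm {n : ℕ} {i j : Fin (n - 1)} (h : (i : ℕ) + 2 ≤ j) :
    (σ i : BraidGroup n) * σ j = σ j * σ i := by
  have := PresentedGroup.one_of_mem (rels := braidRels n) (Or.inl ⟨i, j, h, rfl⟩)
  simp only [map_mul, map_inv] at this
  exact mul_inv_eq_iff_eq_mul.mp (mul_inv_eq_one.mp this)

theorem braid_braid {n : ℕ} {i j : Fin (n - 1)} (h : (j : ℕ) = i + 1) :
    (σ i : BraidGroup n) * σ j * σ i = σ j * σ i * σ j := by
  have := PresentedGroup.one_of_mem (rels := braidRels n) (Or.inr ⟨i, j, h, rfl⟩)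
  simp only [map_mul, map_inv] at this
  exact mul_inv_eq_one.mp this

/-- The homomorphism from `B_3` determined by two elements satisfying the braid relation. -/
def braidThreeLift {H : Type*} [Group H] (a b : H) (h : a * b * a = b * a * b) :
    BraidGroup 3 →* H :=
  PresentedGroup.toGroup (f := ![a, b]) <| by
    rintro r (⟨i, j, hij, rfl⟩ | ⟨i, j, hij, rfl⟩)
    · have := j.isLt
      omega
    · have hi : i = (0 : Fin 2) := by ext; have := j.isLt; simp; omega
      have hj : j = (1 : Fin 2) := by ext; simp [hij, hi]
      subst hi hj
      rw [map_mul, map_inv, mul_inv_eq_one]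
      simpa using h

theorem braidThreeLift_zero {H : Type*} [Group H] {a b : H} (h : a * b * a = b * a * b) :
    braidThreeLift a b h (σ (0 : Fin 2)) = a :=
  PresentedGroup.toGroup.of _

theorem braidThreeLift_one {H : Type*} [Group H] {a b : H} (h : a * b * a = b * a * b) :
    braidThreeLift a b h (σ (1 : Fin 2)) = b :=
  PresentedGroup.toGroup.of _

theorem braidThree_hom_ext {H : Type*} [Group H] {g h : BraidGroup 3 →* H}
    (h0 : g (σ (0 : Fin 2)) = h (σ (0 : Fin 2)))
    (h1 : g (σ (1 : Fin 2)) = h (σ (1 : Fin 2))) : g = h := by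
  refine PresentedGroup.ext fun i => ?_
  change Fin 2 at i
  fin_cases i
  exacts [h0, h1]

theorem braidFour_hom_ext {H : Type*} [Group H] {g h : BraidGroup 4 →* H}
    (h0 : g (σ (0 : Fin 3)) = h (σ (0 : Fin 3)))
    (h1 : g (σ (1 : Fin 3)) = h (σ (1 : Fin 3)))
    (h2 : g (σ (2 : Fin 3)) = h (σ (2 : Fin 3))) : g = h := by
  refine PresentedGroup.ext fun i => ?_
  change Fin 3 at i
  fin_cases i
  exacts [h0, h1, h2]

theorem mul_inv_mem_commutator_of_braid {G : Type*} [Group G] {x y : G}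
    (h : x * y * x = y * x * y) : y * x⁻¹ ∈ commutator G := by
  rw [← Abelianization.ker_of, MonoidHom.mem_ker, map_mul, map_inv, mul_inv_eq_one]
  have := congrArg Abelianization.of h
  simp only [map_mul] at this
  rw [mul_comm (Abelianization.of y)] at this
  exact (mul_left_cancel this).symm

theorem eq_of_braid_of_commute {G : Type*} [Group G] {a b d : G}
    (hab : a * b * a = b * a * b) (hbd : b * d * b = d * b * d) (had : a * d = d * a)
    (h : Commute (d * a⁻¹) (b * a⁻¹)) : d = a := by
  have hca : Commute (d * a⁻¹) a := (show Commute d a from had.symm).mul_left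
    (Commute.refl a).inv_left
  have hcb : Commute (d * a⁻¹) b := by simpa using h.mul_right hca
  obtain ⟨c, rfl⟩ : ∃ c, d = c * a := ⟨d * a⁻¹, by simp⟩
  rw [mul_inv_cancel_right] at hca hcb
  have h1 : b * (c * a) * b = c * (a * b * a) := by
    rw [← mul_assoc b, ← hcb.eq, hab]; simp only [mul_assoc]
  have h2 : c * a * b * (c * a) = c * c * (a * b * a) := by
    calc c * a * b * (c * a) = c * ((a * b) * c) * a := by simp only [mul_assoc]
      _ = c * (c * (a * b)) * a := by rw [(hca.mul_right hcb).eq]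
      _ = _ := by simp only [mul_assoc]
  rw [h1, h2] at hbd
  have := mul_right_cancel hbd
  rw [left_eq_mul] at this
  rw [this, one_mul]

/-! ### Residual nilpotence of the free group of rank two -/

open CongruenceSubgroup MatrixGroups in
theorem commutator_Gamma_le (M N : ℕ) : ⁅Gamma M, Gamma N⁆ ≤ Gamma (M * N) := by
  rw [Subgroup.commutator_le]
  intro u hu v hv
  rw [Gamma_mem', map_commutatorElement, commutatorElement_eq_one_iff_mul_comm, ← map_mul,
    ← map_mul]
  rw [Gamma_mem] at hu hv
  obtain ⟨hu00, hu01, hu10, hu11⟩ := hu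
  obtain ⟨hv00, hv01, hv10, hv11⟩ := hv
  rw [← sub_eq_zero] at hu00 hu11 hv00 hv11
  have key {m : ℕ} {z : ℤ} : (z : ZMod m) = 0 → ∃ k, z = m * k :=
    fun h => (ZMod.intCast_zmod_eq_zero_iff_dvd z m).mp h
  obtain ⟨a, ha⟩ := key (z := u 0 0 - 1) (m := M) (by push_cast; exact hu00)
  obtain ⟨b, hb⟩ := key hu01
  obtain ⟨c, hc⟩ := key hu10
  obtain ⟨d, hd⟩ := key (z := u 1 1 - 1) (m := M) (by push_cast; exact hu11)
  obtain ⟨a', ha'⟩ := key (z := v 0 0 - 1) (m := N) (by push_cast; exact hv00)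
  obtain ⟨b', hb'⟩ := key hv01
  obtain ⟨c', hc'⟩ := key hv10
  obtain ⟨d', hd'⟩ := key (z := v 1 1 - 1) (m := N) (by push_cast; exact hv11)
  rw [sub_eq_iff_eq_add] at ha hd ha' hd'
  ext i j
  rw [SL_reduction_mod_hom_val, SL_reduction_mod_hom_val, ZMod.intCast_eq_intCast_iff_dvd_sub]
  fin_cases i <;> fin_cases j <;>
    simp [Matrix.mul_apply, Fin.sum_univ_two, ha, hb, hc, hd, ha', hb', hc', hd']
  · exact ⟨b' * c - b * c', by ring⟩
  · exact ⟨a' * b + b' * d - a * b' - b * d', by ring⟩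
  · exact ⟨c' * a + d' * c - c * a' - d * c', by ring⟩
  · exact ⟨c' * b - c * b', by ring⟩

open CongruenceSubgroup in
theorem eq_one_of_forall_mem_Gamma_three_pow {g : Matrix.SpecialLinearGroup (Fin 2) ℤ}
    (h : ∀ n : ℕ, g ∈ Gamma (3 ^ (n + 1))) : g = 1 := by
  have key {z : ℤ} (hz : ∀ n : ℕ, (z : ZMod (3 ^ (n + 1))) = 0) : z = 0 := by
    refine Int.eq_zero_of_abs_lt_dvd ((ZMod.intCast_zmod_eq_zero_iff_dvd _ _).mp (hz z.natAbs)) ?_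
    have : z.natAbs < 3 ^ (z.natAbs + 1) :=
      (Nat.lt_succ_self _).trans (Nat.lt_pow_self (by norm_num))
    zify at this
    exact_mod_cast this
  ext i j
  rw [← sub_eq_zero]
  refine key fun n => ?_
  have := Gamma_mem.mp (h n)
  fin_cases i <;> fin_cases j <;> simp [this]

/-- The homomorphism from the free group of rank two to `SL(2, ℤ)` sending the generators to
the elementary matrices with off-diagonal entry `3`. -/
def freeGroupToSL : FreeGroup (Fin 2) →* Matrix.SpecialLinearGroup (Fin 2) ℤ :=
  FreeGroup.lift ![⟨!![1, 3; 0, 1], by simp⟩, ⟨!![1, 0; 3, 1], by simp⟩]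

open CongruenceSubgroup in
theorem freeGroupToSL_mem_Gamma_three (w : FreeGroup (Fin 2)) : freeGroupToSL w ∈ Gamma 3 := by
  have : freeGroupToSL.range ≤ Gamma 3 := by
    refine FreeGroup.range_lift_le ?_
    rintro _ ⟨i, rfl⟩
    fin_cases i <;> exact Gamma_mem.mpr (by simp; decide)
  exact this ⟨w, rfl⟩

open scoped Pointwise in
theorem freeGroupToSL_injective : Function.Injective freeGroupToSL := by
  let a : Fin 2 → Matrix.SpecialLinearGroup (Fin 2) ℤ :=
    ![⟨!![1, 3; 0, 1], by simp⟩, ⟨!![1, 0; 3, 1], by simp⟩]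
  have pow0 (n : ℤ) : (a 0 ^ n).1 = !![1, 3 * n; 0, 1] := by
    have : a 0 = ModularGroup.T ^ (3 : ℤ) := by
      apply Subtype.ext
      rw [ModularGroup.coe_T_zpow]
      rfl
    rw [this, ← zpow_mul, ModularGroup.coe_T_zpow]
  have pow1 (n : ℤ) : (a 1 ^ n).1 = !![1, 0; 3 * n, 1] := by
    have : a 1 = ModularGroup.S * ModularGroup.T ^ (-3 : ℤ) * ModularGroup.S⁻¹ := by decide
    rw [this, conj_zpow, ← zpow_mul, ModularGroup.S_inv]
    simp [ModularGroup.coe_T_zpow, ModularGroup.coe_S]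
  let f : ∀ _ : Fin 2, FreeGroup Unit →* Matrix.SpecialLinearGroup (Fin 2) ℤ :=
    fun i => FreeGroup.lift fun _ => a i
  have factor : freeGroupToSL =
      (Monoid.CoprodI.lift f).comp (freeGroupEquivCoprodI (ι := Fin 2)).toMonoidHom := by
    ext1 i
    simp [freeGroupToSL, f, a]
  let X : Fin 2 → Set (Fin 2 → ℤ) := ![{v | |v 1| < |v 0|}, {v | |v 0| < |v 1|}]
  have disj : Disjoint (X 0) (X 1) :=
    Set.disjoint_left.mpr fun v (h : |v 1| < |v 0|) (h' : |v 0| < |v 1|) => lt_asymm h h'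
  have grow {x y n : ℤ} (hn : n ≠ 0) (h : |x| < |y|) : |y| < |x + 3 * n * y| := by
    have h1 : 1 ≤ |n| := Int.one_le_abs hn
    have h2 : |3 * n * y| = 3 * (|n| * |y|) := by rw [abs_mul, abs_mul, mul_assoc]; rfl
    have h3 : |3 * n * y| ≤ |x + 3 * n * y| + |x| := by
      simpa using abs_sub (x + 3 * n * y) x
    nlinarith [abs_nonneg x, abs_nonneg y]
  rw [factor, MonoidHom.coe_comp]
  refine Function.Injective.comp ?_ (MulEquiv.injective freeGroupEquivCoprodI)
  refine Monoid.CoprodI.lift_injective_of_ping_pong f (.inr ⟨0, ?_⟩) X ?_ ?_ ?_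
  · rw [FreeGroup.freeGroupUnitEquivInt.cardinal_eq, Cardinal.mk_denumerable]
    exact Cardinal.natCast_lt_aleph0.le
  · intro i
    fin_cases i
    · exact ⟨![1, 0], by simp [X]⟩
    · exact ⟨![0, 1], by simp [X]⟩
  · intro i j hij
    fin_cases i <;> fin_cases j
    exacts [absurd rfl hij, disj, disj.symm, absurd rfl hij]
  · intro i j hij
    refine FreeGroup.freeGroupUnitEquivInt.forall_congr_left.mpr fun n hn => ?_
    have hn0 : n ≠ 0 := by
      rintro rfl
      exact hn (by simp [FreeGroup.freeGroupUnitEquivInt])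
    change FreeGroup.lift (fun _ => a i) (FreeGroup.of () ^ n) • X j ⊆ X i
    rw [map_zpow, FreeGroup.lift_apply_of]
    rintro _ ⟨v, hv, rfl⟩
    fin_cases i <;> fin_cases j
    · exact absurd rfl hij
    · change |(a 0 ^ n • v) 1| < |(a 0 ^ n • v) 0|
      rw [Matrix.SpecialLinearGroup.smul_def, pow0]
      simpa [Matrix.vecHead, Matrix.vecTail] using grow hn0 hv
    · change |(a 1 ^ n • v) 0| < |(a 1 ^ n • v) 1|
      rw [Matrix.SpecialLinearGroup.smul_def, pow1]
      have := grow hn0 hv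
      rw [add_comm] at this
      simpa [Matrix.vecHead, Matrix.vecTail] using this
    · exact absurd rfl hij

/-! ### The commutator subgroup of the braid group on three strings -/

/-- The automorphism of the free group of rank two by which the first generator of `B_3` acts. -/
def braidAut : MulAut (FreeGroup (Fin 2)) :=
  MonoidHom.toMulEquiv
    (FreeGroup.lift ![.of 1, (.of 0)⁻¹ * .of 1])
    (FreeGroup.lift ![.of 0 * (.of 1)⁻¹, .of 0])
    (by ext i; fin_cases i <;> simp)
    (by ext i; fin_cases i <;> simp)

theorem braidAut_of_zero : braidAut (.of 0) = .of 1 := by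
  simp [braidAut]

theorem braidAut_of_one : braidAut (.of 1) = (.of 0)⁻¹ * .of 1 := by
  simp [braidAut]

/-- The homomorphism from `B_3` to a semidirect product of a free group of rank two with `ℤ`. -/
def braidThreeToSemidirect :
    BraidGroup 3 →* FreeGroup (Fin 2) ⋊[zpowersHom _ braidAut] Multiplicative ℤ :=
  braidThreeLift (SemidirectProduct.inr (.ofAdd 1))
    (SemidirectProduct.inl (.of 0) * SemidirectProduct.inr (.ofAdd 1)) <| by
    ext <;> simp [pow_two, braidAut_of_zero, braidAut_of_one]

theorem MulAut.map_zpow_apply {N H : Type*} [Group N] [Group H] {θ : MulAut N} {g : N →* H}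
    {a : H} (h : ∀ w, g (θ w) = a * g w * a⁻¹) (n : ℤ) (w : N) :
    g ((θ ^ n) w) = a ^ n * g w * (a ^ n)⁻¹ := by
  induction n generalizing w with
  | zero => simp
  | succ n ih => rw [zpow_add_one, zpow_add_one, MulAut.mul_apply, ih, h]; group
  | pred n ih =>
    have h' : g (θ⁻¹ w) = a⁻¹ * g w * a := by
      have := h (θ⁻¹ w)
      rw [MulAut.apply_inv_self] at this
      rw [this]; group
    rw [zpow_sub_one, zpow_sub_one, MulAut.mul_apply, ih, h']; group

theorem braidThreeToSemidirect_injective : Function.Injective braidThreeToSemidirect := by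
  set a : BraidGroup 3 := σ (0 : Fin 2) with ha
  set b : BraidGroup 3 := σ (1 : Fin 2) with hb
  have hab : a * b * a = b * a * b := braid_braid rfl
  let g : FreeGroup (Fin 2) →* BraidGroup 3 := FreeGroup.lift ![b * a⁻¹, a * b * a⁻¹ * a⁻¹]
  have hg (w : FreeGroup (Fin 2)) : g (braidAut w) = a * g w * a⁻¹ := by
    suffices g.comp braidAut.toMonoidHom = (MulAut.conj a).toMonoidHom.comp g from
      DFunLike.congr_fun this w
    ext i
    fin_cases i
    · simp [g, braidAut_of_zero, mul_assoc]
    · have h : a * b = b * a * b * a⁻¹ := by rw [← hab]; group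
      calc g (braidAut (.of 1)) = (b * a⁻¹)⁻¹ * (a * b * a⁻¹ * a⁻¹) := by
            simp [g, braidAut_of_one]
        _ = a * b⁻¹ * (a * b) * a⁻¹ * a⁻¹ := by group
        _ = a * b⁻¹ * (b * a * b * a⁻¹) * a⁻¹ * a⁻¹ := by rw [← h]
        _ = a * (a * b * a⁻¹ * a⁻¹) * a⁻¹ := by group
        _ = MulAut.conj a (g (.of 1)) := by simp [g]
  let r : FreeGroup (Fin 2) ⋊[zpowersHom _ braidAut] Multiplicative ℤ →* BraidGroup 3 :=
    SemidirectProduct.lift g (zpowersHom _ a) fun n => by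
      ext1 i
      simpa [← map_zpow, -map_mul, -map_inv] using MulAut.map_zpow_apply hg n.toAdd (.of i)
  have : r.comp braidThreeToSemidirect = MonoidHom.id _ := by
    apply braidThree_hom_ext
    · rw [MonoidHom.comp_apply, braidThreeToSemidirect, braidThreeLift_zero]
      simp [r, ha]
    · rw [MonoidHom.comp_apply, braidThreeToSemidirect, braidThreeLift_one]
      simp [r, g, ha, hb]
  exact Function.LeftInverse.injective (g := r) (DFunLike.congr_fun this)

open CongruenceSubgroup commutatorElement in
theorem braidThree_eq_one_of_forall_mem_lowerCentralSeries {y : BraidGroup 3}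
    (hy : ∀ n, y ∈ (commutator (BraidGroup 3)).lowerCentralSeries n) : y = 1 := by
  have key (n : ℕ) : (commutator (BraidGroup 3)).lowerCentralSeries n ≤
      (((Gamma (3 ^ (n + 1))).comap freeGroupToSL).map SemidirectProduct.inl).comap
        braidThreeToSemidirect := by
    induction n with
    | zero =>
      intro x hx
      have hx' : SemidirectProduct.rightHom (braidThreeToSemidirect x) = 1 :=
        Abelianization.commutator_subset_ker
          (SemidirectProduct.rightHom.comp braidThreeToSemidirect) hx
      rw [← MonoidHom.mem_ker, ← SemidirectProduct.range_inl_eq_ker_rightHom] at hx'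
      obtain ⟨w, hw⟩ := hx'
      exact ⟨w, by simpa using freeGroupToSL_mem_Gamma_three w, hw⟩
    | succ n ih =>
      rw [Subgroup.lowerCentralSeries_succ, Subgroup.commutator_le]
      intro x hx z hz
      obtain ⟨w, hw, hwx⟩ := ih hx
      have hz' : SemidirectProduct.rightHom (braidThreeToSemidirect z) = 1 :=
        Abelianization.commutator_subset_ker
          (SemidirectProduct.rightHom.comp braidThreeToSemidirect) hz
      rw [← MonoidHom.mem_ker, ← SemidirectProduct.range_inl_eq_ker_rightHom] at hz'
      obtain ⟨v, hv⟩ := hz'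
      refine ⟨⁅w, v⁆, ?_, by rw [map_commutatorElement, map_commutatorElement, hwx, hv]⟩
      change freeGroupToSL ⁅w, v⁆ ∈ Gamma (3 ^ (n + 1 + 1))
      rw [map_commutatorElement, pow_succ 3 (n + 1)]
      exact commutator_Gamma_le _ _
        (Subgroup.commutator_mem_commutator hw (freeGroupToSL_mem_Gamma_three v))
  obtain ⟨w, -, hw⟩ := key 0 (hy 0)
  have hw1 : freeGroupToSL w = 1 := eq_one_of_forall_mem_Gamma_three_pow fun n => by
    obtain ⟨w', hw', h⟩ := key n (hy n)
    rwa [← SemidirectProduct.inl_injective (h.trans hw.symm)]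
  apply braidThreeToSemidirect_injective
  rw [← hw, map_one, freeGroupToSL_injective (hw1.trans (map_one _).symm), map_one]

/-! ### The kernel of the homomorphism from `B_4` to `B_3` -/

theorem ker_le_of_mul_inv_mem (f : BraidGroup 4 →* BraidGroup 3)
    (hf1 : f (σ (0 : Fin 3)) = σ (0 : Fin 2))
    (hf2 : f (σ (1 : Fin 3)) = σ (1 : Fin 2))
    (hf3 : f (σ (2 : Fin 3)) = σ (0 : Fin 2))
    (N : Subgroup (BraidGroup 4)) [N.Normal]
    (hN : (σ (2 : Fin 3) : BraidGroup 4) * (σ (0 : Fin 3))⁻¹ ∈ N) : f.ker ≤ N := by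
  let q := QuotientGroup.mk' N
  let g : BraidGroup 3 →* BraidGroup 4 ⧸ N :=
    braidThreeLift (q (σ (0 : Fin 3))) (q (σ (1 : Fin 3))) <| by
      simpa only [map_mul] using congrArg q (braid_braid rfl)
  have hg : g.comp f = q := by
    apply braidFour_hom_ext
    · rw [MonoidHom.comp_apply, hf1, braidThreeLift_zero]
    · rw [MonoidHom.comp_apply, hf2, braidThreeLift_one]
    · rw [MonoidHom.comp_apply, hf3, braidThreeLift_zero, eq_comm, ← mul_inv_eq_one, ← map_inv,
        ← map_mul]
      exact (QuotientGroup.eq_one_iff _).mpr hN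
  intro x hx
  rw [← QuotientGroup.ker_mk' N, MonoidHom.mem_ker]
  change q x = 1
  rw [← hg, MonoidHom.comp_apply, MonoidHom.mem_ker.mp hx, map_one]

open commutatorElement in
theorem mul_inv_mem_lowerCentralSeries (n : ℕ) :
    (σ (2 : Fin 3) : BraidGroup 4) * (σ (0 : Fin 3))⁻¹ ∈
      (commutator (BraidGroup 4)).lowerCentralSeries n := by
  set a : BraidGroup 4 := σ (0 : Fin 3)
  set b : BraidGroup 4 := σ (1 : Fin 3)
  set d : BraidGroup 4 := σ (2 : Fin 3)
  have hab : a * b * a = b * a * b := braid_braid rfl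
  have hbd : b * d * b = d * b * d := braid_braid rfl
  have had : a * d = d * a := braid_comm le_rfl
  have hba : b * a⁻¹ ∈ commutator (BraidGroup 4) := mul_inv_mem_commutator_of_braid hab
  induction n with
  | zero => simpa using mul_mem (mul_inv_mem_commutator_of_braid hbd) hba
  | succ n ih =>
    let N := (commutator (BraidGroup 4)).lowerCentralSeries (n + 1)
    let q := QuotientGroup.mk' N
    have hcomm : ⁅d * a⁻¹, b * a⁻¹⁆ ∈ N := Subgroup.commutator_mem_commutator ih hba
    have : q d = q a := by
      refine eq_of_braid_of_commute (b := q b) ?_ ?_ ?_ ?_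
      · simpa only [map_mul] using congrArg q hab
      · simpa only [map_mul] using congrArg q hbd
      · simpa only [map_mul] using congrArg q had
      · rw [← commutatorElement_eq_one_iff_commute, ← map_inv, ← map_mul, ← map_mul,
          ← map_commutatorElement]
        exact (QuotientGroup.eq_one_iff _).mpr hcomm
    rw [← mul_inv_eq_one, ← map_inv, ← map_mul] at this
    exact (QuotientGroup.eq_one_iff _).mp this

theorem mem_ker_iff_forall_mem_lowerCentralSeries (f : BraidGroup 4 →* BraidGroup 3)
    (hf1 : f (σ (0 : Fin 3)) = σ (0 : Fin 2))
    (hf2 : f (σ (1 : Fin 3)) = σ (1 : Fin 2))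
    (hf3 : f (σ (2 : Fin 3)) = σ (0 : Fin 2)) (x : BraidGroup 4) :
    x ∈ f.ker ↔ ∀ n, x ∈ (commutator (BraidGroup 4)).lowerCentralSeries n := by
  refine ⟨fun hx n => ker_le_of_mul_inv_mem f hf1 hf2 hf3 _ (mul_inv_mem_lowerCentralSeries n) hx,
    fun hx => braidThree_eq_one_of_forall_mem_lowerCentralSeries fun n => ?_⟩
  have hle (n : ℕ) : (commutator (BraidGroup 4)).lowerCentralSeries n ≤
      ((commutator (BraidGroup 3)).lowerCentralSeries n).comap f := by
    induction n with
    | zero =>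
      rw [← Subgroup.map_le_iff_le_comap, Subgroup.lowerCentralSeries_zero, commutator_def,
        Subgroup.map_commutator]
      exact Subgroup.commutator_mono le_top le_top
    | succ n ih =>
      rw [← Subgroup.map_le_iff_le_comap, Subgroup.lowerCentralSeries_succ,
        Subgroup.map_commutator]
      refine Subgroup.commutator_mono (Subgroup.map_le_iff_le_comap.mpr ih) ?_
      rw [commutator_def, Subgroup.map_commutator]
      exact Subgroup.commutator_mono le_top le_top
  exact hle n (hx n)

/-- Let `K_4` be the kernel of the homomorphism `B_4 → B_3` determined by `σ₁ ↦ σ₁`,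
`σ₂ ↦ σ₂`, `σ₃ ↦ σ₁`. Then `K_4 ⊆ B'_4`, and `K_4` is a characteristic subgroup of
`B'_4`: every automorphism of `B'_4` maps elements of `K_4` to elements of `K_4`. -/
theorem K4_characteristic (f : BraidGroup 4 →* BraidGroup 3)
    (hf1 : f (σ ⟨0, by omega⟩) = σ ⟨0, by omega⟩)
    (hf2 : f (σ ⟨1, by omega⟩) = σ ⟨1, by omega⟩)
    (hf3 : f (σ ⟨2, by omega⟩) = σ ⟨0, by omega⟩) :
    f.ker ≤ commutator (BraidGroup 4) ∧
    ∀ (φ : MulAut ↥(commutator (BraidGroup 4))) (x : ↥(commutator (BraidGroup 4))),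
      (x : BraidGroup 4) ∈ f.ker → (↑(φ x) : BraidGroup 4) ∈ f.ker := by
  have hker := mem_ker_iff_forall_mem_lowerCentralSeries f hf1 hf2 hf3
  refine ⟨fun x hx => (hker x).mp hx 0, fun φ x hx => (hker _).mpr fun n => ?_⟩
  have hxn := (hker _).mp hx n
  rw [← Subgroup.top_subtype_lowerCentralSeries] at hxn ⊢
  obtain ⟨y, hy, hyx⟩ := hxn
  obtain rfl : y = x := Subtype.ext hyx
  refine ⟨φ y, ?_, rfl⟩
  have := (inferInstance :
    ((⊤ : Subgroup (commutator (BraidGroup 4))).lowerCentralSeries n).Characteristic)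
  exact Subgroup.characteristic_iff_le_comap.mp this φ hy
end

section
/- The matrices T = [[2, 1], [1, 1]] and U = [[1, 1], [1, 2]] generate a free subgroup of SL(2, ℤ) of rank 2; that is, the group homomorphism from the free group on two generators to SL(2, ℤ) sending the generators to T and U is injective. -/
/-- `T = [[2,1],[1,1]] ∈ SL(2,ℤ)`. -/
def Tmat : Matrix.SpecialLinearGroup (Fin 2) ℤ :=
  ⟨!![2, 1; 1, 1], by norm_num [Matrix.det_fin_two_of]⟩

/-- `U = [[1,1],[1,2]] ∈ SL(2,ℤ)`. -/
def Umat : Matrix.SpecialLinearGroup (Fin 2) ℤ :=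
  ⟨!![1, 1; 1, 2], by norm_num [Matrix.det_fin_two_of]⟩

/-- The matrices `g` whose first column `(p, q)` satisfies `p / q ∈ [1, ∞)` for `i = 0`, and
`p / q ∈ [0, 1)` for `i = 1`. -/
def attractingSet (i : Fin 2) : Set (Matrix.SpecialLinearGroup (Fin 2) ℤ) :=
  {g | if i = 0 then
      (0 < g 1 0 ∧ g 1 0 ≤ g 0 0) ∨ (g 1 0 < 0 ∧ g 0 0 ≤ g 1 0)
    else
      (0 ≤ g 0 0 ∧ g 0 0 < g 1 0) ∨ (g 0 0 ≤ 0 ∧ g 1 0 < g 0 0)}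

/-- The matrices `g` whose first column `(p, q)` satisfies `p / q ∈ [-1, 0)` for `i = 0`, and
`p / q ∈ {∞} ∪ (-∞, -1)` for `i = 1`. -/
def repellingSet (i : Fin 2) : Set (Matrix.SpecialLinearGroup (Fin 2) ℤ) :=
  {g | if i = 0 then
      (-g 1 0 ≤ g 0 0 ∧ g 0 0 < 0) ∨ (0 < g 0 0 ∧ g 0 0 ≤ -g 1 0)
    else
      (0 ≤ g 1 0 ∧ g 0 0 < -g 1 0) ∨ (g 1 0 ≤ 0 ∧ -g 1 0 < g 0 0)}

theorem first_column_ne_zero (g : Matrix.SpecialLinearGroup (Fin 2) ℤ) :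
    g 0 0 ≠ 0 ∨ g 1 0 ≠ 0 := by
  by_contra! h
  have hdet := g.2
  rw [Matrix.det_fin_two, h.1, h.2] at hdet
  simp at hdet

theorem first_column_Tmat_mul (g : Matrix.SpecialLinearGroup (Fin 2) ℤ) :
    (Tmat * g) 0 0 = 2 * g 0 0 + g 1 0 ∧ (Tmat * g) 1 0 = g 0 0 + g 1 0 := by
  change (Tmat.1 * g.1) 0 0 = 2 * g.1 0 0 + g.1 1 0 ∧ (Tmat.1 * g.1) 1 0 = g.1 0 0 + g.1 1 0
  simp [Matrix.mul_apply, Fin.sum_univ_two, Tmat]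

theorem first_column_Umat_mul (g : Matrix.SpecialLinearGroup (Fin 2) ℤ) :
    (Umat * g) 0 0 = g 0 0 + g 1 0 ∧ (Umat * g) 1 0 = g 0 0 + 2 * g 1 0 := by
  change (Umat.1 * g.1) 0 0 = g.1 0 0 + g.1 1 0 ∧ (Umat.1 * g.1) 1 0 = g.1 0 0 + 2 * g.1 1 0
  simp [Matrix.mul_apply, Fin.sum_univ_two, Umat]

theorem attractingSet_nonempty (i : Fin 2) : (attractingSet i).Nonempty := by
  fin_cases i
  · exact ⟨Tmat, by simp only [attractingSet]; decide⟩
  · exact ⟨Umat * Umat, by simp only [attractingSet]; decide⟩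

theorem pairwise_disjoint_attractingSet : Pairwise (Function.onFun Disjoint attractingSet) := by
  intro i j hij
  refine Set.disjoint_left.mpr fun g hi hj => ?_
  fin_cases i <;> fin_cases j <;> simp [attractingSet] at hij hi hj <;> omega

theorem pairwise_disjoint_repellingSet : Pairwise (Function.onFun Disjoint repellingSet) := by
  intro i j hij
  refine Set.disjoint_left.mpr fun g hi hj => ?_
  fin_cases i <;> fin_cases j <;> simp [repellingSet] at hij hi hj <;> omega

theorem disjoint_attractingSet_repellingSet (i j : Fin 2) :
    Disjoint (attractingSet i) (repellingSet j) := by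
  refine Set.disjoint_left.mpr fun g hi hj => ?_
  fin_cases i <;> fin_cases j <;> simp [attractingSet, repellingSet] at hi hj <;> omega

open scoped Pointwise in
theorem smul_compl_repellingSet_subset (i : Fin 2) :
    ![Tmat, Umat] i • (repellingSet i)ᶜ ⊆ attractingSet i := by
  rintro _ ⟨g, hg, rfl⟩
  have hne := first_column_ne_zero g
  have hT := first_column_Tmat_mul g
  have hU := first_column_Umat_mul g
  fin_cases i
  · change Tmat * g ∈ attractingSet 0
    simp [attractingSet, repellingSet, -Matrix.SpecialLinearGroup.coe_mul] at hg ⊢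
    omega
  · change Umat * g ∈ attractingSet 1
    simp [attractingSet, repellingSet, -Matrix.SpecialLinearGroup.coe_mul] at hg ⊢
    omega

open scoped Pointwise in
theorem inv_smul_compl_attractingSet_subset (i : Fin 2) :
    ![Tmat, Umat]⁻¹ i • (attractingSet i)ᶜ ⊆ repellingSet i := by
  rw [Pi.inv_apply, ← Set.subset_smul_set_iff, Set.compl_subset_comm, ← Set.smul_set_compl]
  exact smul_compl_repellingSet_subset i

/-- The matrices `T = [[2,1],[1,1]]` and `U = [[1,1],[1,2]]` generate a free subgroup
of `SL(2,ℤ)` of rank 2: any homomorphism from the free group on two generators to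
`SL(2,ℤ)` sending the generators to `T` and `U` is injective. -/
theorem T_U_generate_free_subgroup
    (f : FreeGroup (Fin 2) →* Matrix.SpecialLinearGroup (Fin 2) ℤ)
    (hf0 : f (FreeGroup.of 0) = Tmat) (hf1 : f (FreeGroup.of 1) = Umat) :
    Function.Injective f := by
  have hf : f = FreeGroup.lift ![Tmat, Umat] := by
    ext1 i
    fin_cases i
    · simpa using hf0
    · simpa using hf1
  rw [hf]
  exact FreeGroup.injective_lift_of_ping_pong _ _ _ attractingSet_nonempty
    pairwise_disjoint_attractingSet pairwise_disjoint_repellingSet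
    disjoint_attractingSet_repellingSet smul_compl_repellingSet_subset
    inv_smul_compl_attractingSet_subset
end
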